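/- Let ε > 0. Suppose Assumptions 1 and 2 hold, K_ε := {w ∈ ℝˢ : dist(w, A(S)) ≤ ε} ⊆ int(dom g), g is essentially strictly convex, and one of the following holds: (i) f* is calm at every point of its effective domain and Γ satisfies the KL property at every point of the domain of its limiting subdifferential; or (ii) f is differentiable with Lipschitz continuous gradient on an open set containing K(S) and Π satisfies the KL property at every point of the domain of its limiting subdifferential. Let (x^k, y^k, z^k, u^k, θ_k)_{k≥0} be generated by the constant-parameter algorithm with ‖z^{k+1}‖ ≤ min(ε/γ, √(2ε/γ)) for all k ≥ 0. Then Σ_k (‖x^k−x^{k+1}‖ + ‖u^k−u^{k+1}‖ + ‖z^k−z^{k+1}‖) < +∞, and the sequence {x^k} converges to a limiting (2κε, (2κ+1)ε)-lifted stationary point of problem (P), where κ is the Lipschitz constant of g on K_ε. -/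

import Mathlib

open Set Filter Topology Metric

open scoped RealInnerProductSpace

noncomputable section

namespace FracPaper

variable {E : Type*} [NormedAddCommGroup E] [InnerProductSpace ℝ E] [FiniteDimensional ℝ E]
variable {F : Type*} [NormedAddCommGroup F] [InnerProductSpace ℝ F] [FiniteDimensional ℝ F]
variable {G : Type*} [NormedAddCommGroup G] [InnerProductSpace ℝ G] [FiniteDimensional ℝ G]

/-- The effective domain of an `EReal`-valued function. -/
def edom (f : E → EReal) : Set E := {x | f x ≠ ⊤}

/-- `f` is proper: it takes values in `ℝ ∪ {+∞}` and is not identically `+∞`. -/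
def ProperFn (f : E → EReal) : Prop := (∀ x, f x ≠ ⊥) ∧ ∃ x, f x ≠ ⊤

/-- Convexity for `EReal`-valued functions. -/
def ConvexFn (f : E → EReal) : Prop :=
  ∀ x y : E, ∀ a b : ℝ, 0 ≤ a → 0 ≤ b → a + b = 1 →
    f (a • x + b • y) ≤ (a : EReal) * f x + (b : EReal) * f y

/-- The Fenchel conjugate of an `EReal`-valued function. -/
def conj (f : E → EReal) : E → EReal :=
  fun v => ⨆ x : E, ((⟪v, x⟫ : EReal) - f x)

/-- The `ε`-subdifferential (for convex functions). -/
def epsSubdiff (f : E → EReal) (ε : ℝ) (w : E) : Set E :=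
  {v | f w ≠ ⊤ ∧ ∀ y : E, f w + ((⟪v, y - w⟫ - ε : ℝ) : EReal) ≤ f y}

/-- The convex subdifferential. -/
def subdiff (f : E → EReal) (w : E) : Set E := epsSubdiff f 0 w

/-- The Fréchet subdifferential. -/
def frechetSubdiff (f : E → EReal) (w : E) : Set E :=
  {v | f w ≠ ⊤ ∧ ∀ ε : ℝ, 0 < ε →
    ∀ᶠ y in nhds w, f w + ((⟪v, y - w⟫ - ε * ‖y - w‖ : ℝ) : EReal) ≤ f y}

/-- The limiting (Mordukhovich) subdifferential. -/
def limitingSubdiff (f : E → EReal) (w : E) : Set E :=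
  {v | ∃ xs vs : ℕ → E,
      Tendsto xs atTop (nhds w) ∧
      Tendsto (fun k => f (xs k)) atTop (nhds (f w)) ∧
      Tendsto vs atTop (nhds v) ∧
      ∀ k, vs k ∈ frechetSubdiff f (xs k)}

open Classical in
/-- The indicator function of a set, with values in `EReal`. -/
def indicatorFn (S : Set E) : E → EReal := fun x => if x ∈ S then (0 : EReal) else ⊤

/-- Calmness of an `EReal`-valued function at a point. -/
def CalmAt (f : E → EReal) (x : E) : Prop :=
  ∃ ε κ : ℝ, 0 < ε ∧ 0 < κ ∧ ∀ y ∈ ball x ε,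
    f y ≤ f x + ((κ * ‖y - x‖ : ℝ) : EReal) ∧ f x ≤ f y + ((κ * ‖y - x‖ : ℝ) : EReal)

/-- Essential strict convexity: strict convexity on every convex subset of `dom ∂g`. -/
def EssStrictConvexFn (g : F → EReal) : Prop :=
  ∀ C : Set F, Convex ℝ C → (∀ w ∈ C, (subdiff g w).Nonempty) →
    ∀ x ∈ C, ∀ y ∈ C, x ≠ y → ∀ a b : ℝ, 0 < a → 0 < b → a + b = 1 →
      g (a • x + b • y) < (a : EReal) * g x + (b : EReal) * g y

/-- The Kurdyka–Łojasiewicz property at a point. -/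
def KLAt (f : E → EReal) (xh : E) : Prop :=
  ∃ μ : ℝ, 0 < μ ∧ ∃ U ∈ nhds xh, ∃ φ φd : ℝ → ℝ,
    ContinuousOn φ (Ico 0 μ) ∧ ConcaveOn ℝ (Ico 0 μ) φ ∧ φ 0 = 0 ∧
    (∀ t ∈ Ioo 0 μ, HasDerivAt φ (φd t) t ∧ 0 < φd t) ∧
    ∀ x ∈ U, f xh < f x → f x < f xh + (μ : EReal) →
      ∀ v ∈ limitingSubdiff f x, 1 ≤ φd ((f x).toReal - (f xh).toReal) * ‖v‖

/-- The augmented function `Ψ`. -/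
def psi (S : Set E) (g : F → EReal) (h : E → ℝ) (A : E →L[ℝ] F) (δ γ : ℝ)
    (x : E) (z : F) (u : E) : EReal :=
  ((⟪z, A x⟫ + h x + δ / 2 * ‖x - u‖ ^ 2 - γ / 2 * ‖z‖ ^ 2 : ℝ) : EReal)
    - conj g z + indicatorFn S x

/-- Assumption 1 of the paper. `h'` is the gradient of `h` and `Lh` its Lipschitz constant. -/
def Assumption1 (S : Set E) (g : F → EReal) (h : E → ℝ) (h' : E → E) (Lh : ℝ)
    (f : G → EReal) (A : E →L[ℝ] F) (K : E →L[ℝ] G) : Prop :=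
  S.Nonempty ∧ Convex ℝ S ∧ IsCompact S ∧
  ProperFn g ∧ ConvexFn g ∧ LowerSemicontinuous g ∧
  (∃ O : Set E, IsOpen O ∧ S ⊆ O ∧ (∀ x ∈ O, HasGradientAt h (h' x) x) ∧
      ∀ x ∈ O, ∀ y ∈ O, ‖h' x - h' y‖ ≤ Lh * ‖x - y‖) ∧
  ProperFn f ∧ ConvexFn f ∧ LowerSemicontinuous f ∧
  (∀ x ∈ S, K x ∈ interior (edom f)) ∧ (∀ x ∈ S, 0 < f (K x)) ∧
  (∃ x ∈ S, A x ∈ edom g) ∧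
  (∃ α : ℝ, 0 < α ∧ ∀ x ∈ S, (α : EReal) ≤ g (A x) + (h x : EReal))

/-- Assumption 2 of the paper. -/
def Assumption2 (S : Set E) (g : F → EReal) (A : E →L[ℝ] F) : Prop :=
  (∀ x ∈ S, (subdiff g (A x)).Nonempty) ∧
  ∃ ℓ : ℝ, 0 < ℓ ∧ ∀ x ∈ S, infDist 0 (subdiff g (A x)) ≤ ℓ

/-- The constant-parameter algorithm (FSPS with fixed `γ`, `δ`, `β`). -/
def IsAlgoSeq (S : Set E) (g : F → EReal) (h : E → ℝ) (h' : E → E) (f : G → EReal)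
    (A : E →L[ℝ] F) (K : E →L[ℝ] G) (γ δ β : ℝ)
    (x u : ℕ → E) (y : ℕ → G) (z : ℕ → F) (θ : ℕ → ℝ) : Prop :=
  x 0 ∈ S ∧
  (∀ k, ∀ ζ : F, conj g (z k) + ((-⟪z k, A (x k)⟫ + γ / 2 * ‖z k‖ ^ 2 : ℝ) : EReal)
      ≤ conj g ζ + ((-⟪ζ, A (x k)⟫ + γ / 2 * ‖ζ‖ ^ 2 : ℝ) : EReal)) ∧
  (∀ k, 0 < θ k ∧ ((θ k : ℝ) : EReal) * f (K (x k)) = psi S g h A δ γ (x k) (z k) (u k)) ∧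
  (∀ k, y (k + 1) ∈ subdiff f (K (x k))) ∧
  (∀ k, x (k + 1) ∈ S ∧ ∀ w ∈ S,
      ⟪z k, A (x (k + 1))⟫ - θ k * ⟪K (x (k + 1)), y (k + 1)⟫
          + ⟪h' (x k), x (k + 1)⟫ + δ / 2 * ‖x (k + 1) - u k‖ ^ 2
        ≤ ⟪z k, A w⟫ - θ k * ⟪K w, y (k + 1)⟫ + ⟪h' (x k), w⟫
          + δ / 2 * ‖w - u k‖ ^ 2) ∧
  (∀ k, u (k + 1) = (1 - β) • u k + β • x (k + 1))

/-- `x̄` is a limiting `(ε₁, ε₂)`-lifted stationary point of the fractional program. -/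
def IsLiftedStat (S : Set E) (g : F → EReal) (h : E → ℝ) (h' : E → E) (f : G → EReal)
    (A : E →L[ℝ] F) (K : E →L[ℝ] G) (ε₁ ε₂ : ℝ) (xb : E) : Prop :=
  ∃ Ψb : ℝ, |Ψb - ((g (A xb)).toReal + h xb)| ≤ ε₂ ∧
    ∃ v ∈ epsSubdiff g ε₁ (A xb), ∃ w ∈ subdiff (indicatorFn S) xb,
      ∃ s ∈ subdiff f (K xb),
        (f (K xb)).toReal • (ContinuousLinearMap.adjoint A v + h' xb + w)
          - Ψb • (ContinuousLinearMap.adjoint K s) = 0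


open Classical in
/-- The merit function `Γ` on the `ℓ²`-product space, extended by `+∞` outside the
region where the denominator exceeds `m/2`. -/
def gamFn (S : Set E) (g : F → EReal) (h : E → ℝ) (f : G → EReal)
    (A : E →L[ℝ] F) (K : E →L[ℝ] G) (δ γ m : ℝ) :
    WithLp 2 (E × WithLp 2 (G × WithLp 2 (F × E))) → EReal := fun q =>
  if ((m / 2 : ℝ) : EReal)
      < ((⟪K (WithLp.equiv 2 _ q).1, (WithLp.equiv 2 _ (WithLp.equiv 2 _ q).2).1⟫ : ℝ) : EReal)
          - conj f (WithLp.equiv 2 _ (WithLp.equiv 2 _ q).2).1 then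
    psi S g h A δ γ (WithLp.equiv 2 _ q).1
        (WithLp.equiv 2 _ (WithLp.equiv 2 _ (WithLp.equiv 2 _ q).2).2).1
        (WithLp.equiv 2 _ (WithLp.equiv 2 _ (WithLp.equiv 2 _ q).2).2).2
      / (((⟪K (WithLp.equiv 2 _ q).1, (WithLp.equiv 2 _ (WithLp.equiv 2 _ q).2).1⟫ : ℝ) : EReal)
          - conj f (WithLp.equiv 2 _ (WithLp.equiv 2 _ q).2).1)
  else ⊤

/-- Bundling `(x, y, z, u)` as a point of the `ℓ²`-product space. -/
def mkQuad (a : E) (b : G) (c : F) (d : E) :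
    WithLp 2 (E × WithLp 2 (G × WithLp 2 (F × E))) :=
  (WithLp.equiv 2 _).symm (a, (WithLp.equiv 2 _).symm (b, (WithLp.equiv 2 _).symm (c, d)))

/-- The merit function `Π` on the `ℓ²`-product space. -/
def piFn (S : Set E) (g : F → EReal) (h : E → ℝ) (f : G → EReal)
    (A : E →L[ℝ] F) (K : E →L[ℝ] G) (δ γ : ℝ) :
    WithLp 2 (E × WithLp 2 (F × E)) → EReal := fun q =>
  psi S g h A δ γ (WithLp.equiv 2 _ q).1
      (WithLp.equiv 2 _ (WithLp.equiv 2 _ q).2).1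
      (WithLp.equiv 2 _ (WithLp.equiv 2 _ q).2).2
    / f (K (WithLp.equiv 2 _ q).1)

/-- Bundling `(x, z, u)` as a point of the `ℓ²`-product space. -/
def mkTrip (a : E) (c : F) (d : E) : WithLp 2 (E × WithLp 2 (F × E)) :=
  (WithLp.equiv 2 _).symm (a, (WithLp.equiv 2 _).symm (c, d))

set_option linter.unusedSectionVars false

section ConvexAnalysis

theorem exists_real_of_ne_top {f : E → EReal} (hb : ∀ x, f x ≠ ⊥) {x : E} (hx : f x ≠ ⊤) :
    ∃ r : ℝ, f x = r :=
  ⟨(f x).toReal, (EReal.coe_toReal hx (hb x)).symm⟩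

theorem coe_le_of_forall_real {a : ℝ} {b : EReal} (h : ∀ s : ℝ, b ≤ s → a ≤ s) :
    (a : EReal) ≤ b := by
  induction b with
  | bot => have := h (a - 1) bot_le; linarith
  | top => exact le_top
  | coe s => exact EReal.coe_le_coe_iff.2 (h s le_rfl)

theorem mem_subdiff_iff {f : E → EReal} {w v : E} {r : ℝ} (hr : f w = r) :
    v ∈ subdiff f w ↔ ∀ y, ∀ s : ℝ, f y ≤ s → r + ⟪v, y - w⟫ ≤ s := by
  simp only [subdiff, epsSubdiff, mem_ofPred_eq, hr, sub_zero]
  constructor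
  · rintro ⟨-, h⟩ y s hs
    have := (h y).trans hs
    exact_mod_cast this
  · intro h
    refine ⟨EReal.coe_ne_top _, fun y => ?_⟩
    rw [← EReal.coe_add]
    exact coe_le_of_forall_real (h y)

theorem le_conj {f : E → EReal} {w : E} {r : ℝ} (hr : f w = r) (v : E) :
    ((⟪v, w⟫ - r : ℝ) : EReal) ≤ conj f v := by
  have := le_iSup (fun x : E => ((⟪v, x⟫ : EReal) - f x)) w
  simp only [hr] at this
  exact_mod_cast this

theorem conj_le {f : E → EReal} (hb : ∀ x, f x ≠ ⊥) {v : E} {c : ℝ}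
    (h : ∀ y, ∀ s : ℝ, f y = s → ⟪v, y⟫ - s ≤ c) : conj f v ≤ c := by
  refine iSup_le fun y => ?_
  by_cases hy : f y = ⊤
  · simp [hy]
  · obtain ⟨s, hs⟩ := exists_real_of_ne_top hb hy
    rw [hs]
    exact_mod_cast h y s hs

theorem conj_eq_of_mem_subdiff {f : E → EReal} (hb : ∀ x, f x ≠ ⊥) {w v : E} {r : ℝ}
    (hr : f w = r) (hv : v ∈ subdiff f w) : conj f v = ((⟪v, w⟫ - r : ℝ) : EReal) := by
  refine le_antisymm (conj_le hb fun y s hs => ?_) (le_conj hr v)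
  have := (mem_subdiff_iff hr).1 hv y s hs.le
  rw [inner_sub_right] at this
  linarith

theorem ConvexFn.le_real {f : E → EReal} (hf : ConvexFn f) {x y : E} {r s : ℝ} (hx : f x ≤ r)
    (hy : f y ≤ s) {a b : ℝ} (ha : 0 ≤ a) (hb : 0 ≤ b) (hab : a + b = 1) :
    f (a • x + b • y) ≤ ((a * r + b * s : ℝ) : EReal) := by
  refine (hf x y a b ha hb hab).trans ?_
  rw [EReal.coe_add, EReal.coe_mul, EReal.coe_mul]
  exact add_le_add (mul_le_mul_of_nonneg_left hx (EReal.coe_nonneg.2 ha))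
    (mul_le_mul_of_nonneg_left hy (EReal.coe_nonneg.2 hb))

theorem ConvexFn.convexOn_toReal {f : E → EReal} (hf : ConvexFn f) (hb : ∀ x, f x ≠ ⊥) :
    ConvexOn ℝ (edom f) (fun x => (f x).toReal) := by
  have key : ∀ x ∈ edom f, ∀ y ∈ edom f, ∀ a b : ℝ, 0 ≤ a → 0 ≤ b → a + b = 1 →
      f (a • x + b • y) ≤ ((a * (f x).toReal + b * (f y).toReal : ℝ) : EReal) := by
    intro x hx y hy a b ha hb' hab
    exact hf.le_real (EReal.coe_toReal hx (hb x)).ge (EReal.coe_toReal hy (hb y)).ge ha hb' hab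
  refine ⟨fun x hx y hy a b ha hb' hab => ?_, fun x hx y hy a b ha hb' hab => ?_⟩
  · exact ne_top_of_le_ne_top (EReal.coe_ne_top _) (key x hx y hy a b ha hb' hab)
  · have h1 := key x hx y hy a b ha hb' hab
    have h2 := EReal.coe_toReal (ne_top_of_le_ne_top (EReal.coe_ne_top _) h1) (hb _)
    rw [← h2] at h1
    simpa using EReal.coe_le_coe_iff.1 h1

theorem ConvexFn.continuousAt_toReal {f : E → EReal} (hf : ConvexFn f) (hb : ∀ x, f x ≠ ⊥)
    {x : E} (hx : x ∈ interior (edom f)) : ContinuousAt (fun x => (f x).toReal) x :=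
  (hf.convexOn_toReal hb).continuousOn_interior.continuousAt (isOpen_interior.mem_nhds hx)

/-- A minimizer `w` of `g + ‖· - c‖² / (2γ)` gives a subgradient `(c - w) / γ`. -/
theorem exists_prox_subgradient {g : F → EReal} (hb : ∀ x, g x ≠ ⊥) (hg : ConvexFn g)
    (hlsc : LowerSemicontinuous g) {w₀ v₀ : F} (hv₀ : v₀ ∈ subdiff g w₀) {γ : ℝ} (hγ : 0 < γ)
    (c : F) : ∃ z, z ∈ subdiff g (c - γ • z) := by
  obtain ⟨r₀, hr₀⟩ := exists_real_of_ne_top hb hv₀.1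
  set R := ‖c - w₀‖ + 2 * γ * ‖v₀‖ with hR
  set q : F → ℝ := fun w => 1 / (2 * γ) * ‖w - c‖ ^ 2 with hq
  have hqc : Continuous q := by fun_prop
  have hl : LowerSemicontinuous fun w => g w + (q w : EReal) := by
    refine hlsc.add' (continuous_coe_real_ereal.comp hqc).lowerSemicontinuous fun x => ?_
    exact EReal.continuousAt_add (Or.inr (EReal.coe_ne_bot _)) (Or.inl (hb x))
  have hw₀ : w₀ ∈ closedBall c R := by
    rw [mem_closedBall, dist_comm, dist_eq_norm]
    have : 0 ≤ 2 * γ * ‖v₀‖ := by positivity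
    linarith
  obtain ⟨w, -, hw⟩ := LowerSemicontinuousOn.exists_isMinOn ⟨w₀, hw₀⟩
    (isCompact_closedBall c R) (hl.lowerSemicontinuousOn _)
  have hglob : ∀ y, g w + (q w : EReal) ≤ g y + (q y : EReal) := by
    intro y
    by_cases hy : y ∈ closedBall c R
    · exact hw hy
    refine (hw hw₀).trans ?_
    show g w₀ + (q w₀ : EReal) ≤ g y + (q y : EReal)
    by_cases hyt : g y = ⊤
    · rw [hyt, EReal.top_add_coe]; exact le_top
    obtain ⟨s, hs⟩ := exists_real_of_ne_top hb hyt
    rw [hs, hr₀, ← EReal.coe_add, ← EReal.coe_add, EReal.coe_le_coe_iff]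
    have h1 := (mem_subdiff_iff hr₀).1 hv₀ y s hs.le
    have h2 : -(‖v₀‖ * (‖y - c‖ + ‖c - w₀‖)) ≤ ⟪v₀, y - w₀⟫ := by
      have h3 := neg_le_of_abs_le (abs_real_inner_le_norm v₀ (y - w₀))
      have h4 : ‖y - w₀‖ ≤ ‖y - c‖ + ‖c - w₀‖ := by
        have := norm_add_le (y - c) (c - w₀); simpa using this
      nlinarith [norm_nonneg v₀]
    rw [mem_closedBall, dist_eq_norm, not_le] at hy
    have h5 : ‖v₀‖ * (‖y - c‖ + ‖c - w₀‖) + q w₀ ≤ q y := by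
      simp only [hq]
      rw [norm_sub_rev w₀ c, ← sub_nonneg]
      have : 1 / (2 * γ) * ‖y - c‖ ^ 2 - (‖v₀‖ * (‖y - c‖ + ‖c - w₀‖)
          + 1 / (2 * γ) * ‖c - w₀‖ ^ 2)
          = (‖y - c‖ + ‖c - w₀‖) * (‖y - c‖ - ‖c - w₀‖ - 2 * γ * ‖v₀‖) / (2 * γ) := by
        field_simp; ring
      rw [this]
      apply div_nonneg _ (by positivity)
      apply mul_nonneg (by positivity)
      linarith
    linarith
  have hwt : g w ≠ ⊤ := by
    intro h
    have := hglob w₀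
    rw [h, EReal.top_add_coe, hr₀, ← EReal.coe_add] at this
    exact EReal.coe_ne_top _ (top_le_iff.1 this)
  obtain ⟨r, hr⟩ := exists_real_of_ne_top hb hwt
  refine ⟨γ⁻¹ • (c - w), ?_⟩
  have hcw : c - γ • γ⁻¹ • (c - w) = w := by
    rw [smul_smul, mul_inv_cancel₀ hγ.ne', one_smul]; abel
  rw [hcw, mem_subdiff_iff hr]
  intro y s hs
  have key : ∀ t ∈ Ioo (0 : ℝ) 1,
      r + ⟪γ⁻¹ • (c - w), y - w⟫ ≤ s + t * (1 / (2 * γ) * ‖y - w‖ ^ 2) := by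
    intro t ht
    have h1 := (hglob ((1 - t) • w + t • y)).trans
      (add_le_add_left (hg.le_real hr.le hs (by linarith [ht.2]) ht.1.le (by ring)) _)
    rw [hr, ← EReal.coe_add, ← EReal.coe_add, EReal.coe_le_coe_iff] at h1
    have h2 : (1 - t) • w + t • y - c = (w - c) + t • (y - w) := by module
    have h3 : ⟪γ⁻¹ • (c - w), y - w⟫ = - (γ⁻¹ * ⟪w - c, y - w⟫) := by
      rw [inner_smul_left, ← neg_sub w c, inner_neg_left]; simp
    simp only [hq, h2, norm_add_sq_real, inner_smul_right, norm_smul, mul_pow,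
      Real.norm_eq_abs, sq_abs] at h1
    rw [h3]
    have h4 : t * (r - γ⁻¹ * ⟪w - c, y - w⟫) ≤ t * (s + t * (1 / (2 * γ) * ‖y - w‖ ^ 2)) := by
      have e : 1 / (2 * γ) = γ⁻¹ / 2 := by field_simp
      rw [e] at h1 ⊢
      nlinarith
    have := le_of_mul_le_mul_left h4 ht.1
    linarith
  have hlim : Tendsto (fun t : ℝ => s + t * (1 / (2 * γ) * ‖y - w‖ ^ 2)) (𝓝[>] 0)
      (𝓝 (s + 0 * (1 / (2 * γ) * ‖y - w‖ ^ 2))) := by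
    apply Tendsto.mono_left _ nhdsWithin_le_nhds
    exact Continuous.tendsto (by fun_prop) _
  rw [zero_mul, add_zero] at hlim
  refine ge_of_tendsto hlim ?_
  filter_upwards [Ioo_mem_nhdsGT (zero_lt_one' ℝ)] with t ht using key t ht

/-- The proximal point of the conjugate is characterized by a subgradient of `g`. -/
theorem mem_subdiff_of_prox_conj {g : F → EReal} (hb : ∀ x, g x ≠ ⊥) (hg : ConvexFn g)
    (hlsc : LowerSemicontinuous g) {w₀ v₀ : F} (hv₀ : v₀ ∈ subdiff g w₀) {γ : ℝ} (hγ : 0 < γ)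
    {c z : F} (hz : ∀ ζ, conj g z + ((-⟪z, c⟫ + γ / 2 * ‖z‖ ^ 2 : ℝ) : EReal)
      ≤ conj g ζ + ((-⟪ζ, c⟫ + γ / 2 * ‖ζ‖ ^ 2 : ℝ) : EReal)) :
    z ∈ subdiff g (c - γ • z) := by
  obtain ⟨z', hz'⟩ := exists_prox_subgradient hb hg hlsc hv₀ hγ c
  suffices z = z' by rw [this]; exact hz'
  obtain ⟨r, hr⟩ := exists_real_of_ne_top hb hz'.1
  have h1 := hz z'
  rw [conj_eq_of_mem_subdiff hb hr hz'] at h1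
  have h2 := (add_le_add_left (le_conj hr z) _).trans h1
  rw [← EReal.coe_add, ← EReal.coe_add, EReal.coe_le_coe_iff] at h2
  simp only [inner_sub_right, inner_smul_right, real_inner_self_eq_norm_sq] at h2
  have h3 : ‖z - z'‖ ^ 2 ≤ 0 := by
    rw [norm_sub_sq_real]
    nlinarith
  have h4 : ‖z - z'‖ = 0 := by
    have := sq_nonneg ‖z - z'‖
    exact pow_eq_zero_iff (two_ne_zero) |>.1 (le_antisymm h3 this)
  exact sub_eq_zero.1 (norm_eq_zero.1 h4)

theorem eq_of_mem_subdiff_of_le {g : F → EReal} (hg : ConvexFn g)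
    (hess : EssStrictConvexFn g) {w z w' : F} {r : ℝ} (hr : g w = r) (hz : z ∈ subdiff g w)
    (hw' : g w' ≤ ((r + ⟪z, w' - w⟫ : ℝ) : EReal)) : w' = w := by
  by_contra hne
  have hmin := (mem_subdiff_iff hr).1 hz
  have hseg : ∀ p ∈ segment ℝ w w', g p = ((r + ⟪z, p - w⟫ : ℝ) : EReal) := by
    rintro p ⟨a, b, ha, hb', hab, rfl⟩
    refine le_antisymm ?_ (coe_le_of_forall_real fun s hs => hmin _ s hs)
    refine (hg.le_real hr.le hw' ha hb' hab).trans (EReal.coe_le_coe_iff.2 (le_of_eq ?_))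
    have : a • w + b • w' - w = b • (w' - w) := by
      rw [← eq_sub_iff_add_eq] at hab; subst hab; module
    rw [this, inner_smul_right]
    linear_combination r * hab
  have hsub : ∀ p ∈ segment ℝ w w', (subdiff g p).Nonempty := by
    intro p hp
    refine ⟨z, (mem_subdiff_iff (hseg p hp)).2 fun y s hs => ?_⟩
    have := hmin y s hs
    rw [add_assoc, ← inner_add_right]
    simpa using this
  have h := hess _ (convex_segment w w') hsub w (left_mem_segment ℝ w w') w'
    (right_mem_segment ℝ w w') (Ne.symm hne) (1 / 2) (1 / 2) (by norm_num) (by norm_num)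
    (by norm_num)
  rw [hseg _ ⟨1 / 2, 1 / 2, by norm_num, by norm_num, by norm_num, rfl⟩,
    hseg w (left_mem_segment ℝ w w'), hseg w' (right_mem_segment ℝ w w'), ← EReal.coe_mul,
    ← EReal.coe_mul, ← EReal.coe_add, EReal.coe_lt_coe_iff] at h
  have e : (1 / 2 : ℝ) • w + (1 / 2 : ℝ) • w' - w = (1 / 2 : ℝ) • (w' - w) := by module
  rw [e, inner_smul_right] at h
  simp only [sub_self, inner_zero_right] at h
  linarith

/-- First-order upper expansion of the conjugate of an essentially strictly convex function. -/
theorem conj_le_of_essStrictConvex {g : F → EReal} (hb : ∀ x, g x ≠ ⊥) (hg : ConvexFn g)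
    (hlsc : LowerSemicontinuous g) (hess : EssStrictConvexFn g) {w z : F} {r : ℝ}
    (hr : g w = r) (hz : z ∈ subdiff g w) {ρ : ℝ} (hρ : 0 < ρ) :
    ∀ᶠ z' in 𝓝 z, conj g z' ≤ ((⟪z', w⟫ - r + ρ * ‖z' - z‖ : ℝ) : EReal) := by
  have hmin := (mem_subdiff_iff hr).1 hz
  -- a uniform gap on the sphere of radius `ρ`
  obtain ⟨c, hc, hgap⟩ : ∃ c : ℝ, 0 < c ∧ ∀ p, ‖p - w‖ = ρ → ∀ s : ℝ, g p ≤ s →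
      r + ⟪z, p - w⟫ + c ≤ s := by
    by_cases hne : (sphere w ρ).Nonempty
    · have hl : LowerSemicontinuous fun p => g p + ((-(r + ⟪z, p - w⟫) : ℝ) : EReal) := by
        refine hlsc.add' (continuous_coe_real_ereal.comp (by fun_prop)).lowerSemicontinuous
          fun x => ?_
        exact EReal.continuousAt_add (Or.inr (EReal.coe_ne_bot _)) (Or.inl (hb x))
      obtain ⟨p₀, hp₀, hpm⟩ := LowerSemicontinuousOn.exists_isMinOn hne
        (isCompact_sphere w ρ) (hl.lowerSemicontinuousOn _)
      have hpos : (0 : EReal) < g p₀ + ((-(r + ⟪z, p₀ - w⟫) : ℝ) : EReal) := by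
        by_contra hcon
        rw [not_lt] at hcon
        have h1 : g p₀ ≤ ((r + ⟪z, p₀ - w⟫ : ℝ) : EReal) := by
          by_cases ht : g p₀ = ⊤
          · rw [ht, EReal.top_add_coe] at hcon
            exact absurd hcon (by simp)
          · obtain ⟨s, hs⟩ := exists_real_of_ne_top hb ht
            rw [hs, ← EReal.coe_add, ← EReal.coe_zero, EReal.coe_le_coe_iff] at hcon
            rw [hs, EReal.coe_le_coe_iff]
            linarith
        have h2 := eq_of_mem_subdiff_of_le hg hess hr hz h1
        rw [h2, mem_sphere, dist_self] at hp₀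
        exact hρ.ne hp₀
      obtain ⟨c, hc0, hc1⟩ := EReal.lt_iff_exists_real_btwn.1 hpos
      refine ⟨c, by exact_mod_cast hc0, fun p hp s hs => ?_⟩
      have h3 := hc1.le.trans (hpm (show p ∈ sphere w ρ by rwa [mem_sphere, dist_eq_norm]))
      have h4 := h3.trans (add_le_add_left hs _)
      rw [← EReal.coe_add, EReal.coe_le_coe_iff] at h4
      linarith
    · exact ⟨1, one_pos, fun p hp => absurd ⟨p, by rwa [mem_sphere, dist_eq_norm]⟩ hne⟩
  have hfar : ∀ p, ρ ≤ ‖p - w‖ → ∀ s : ℝ, g p ≤ s → r + ⟪z, p - w⟫ + c / ρ * ‖p - w‖ ≤ s := by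
    intro p hp s hs
    have hn : 0 < ‖p - w‖ := hρ.trans_le hp
    set t := ρ / ‖p - w‖ with ht
    have ht0 : 0 < t := by positivity
    have ht1 : t ≤ 1 := by rw [ht, div_le_one hn]; exact hp
    have hpt : (1 - t) • w + t • p - w = t • (p - w) := by module
    have hnorm : ‖(1 - t) • w + t • p - w‖ = ρ := by
      rw [hpt, norm_smul, Real.norm_of_nonneg ht0.le, ht, div_mul_cancel₀ _ hn.ne']
    have h1 := hgap _ hnorm _ (hg.le_real hr.le hs (by linarith) ht0.le (by ring))
    rw [hpt, inner_smul_right] at h1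
    have h2 : t * (c / ρ * ‖p - w‖) = c := by rw [ht]; field_simp
    have h3 : t * (r + ⟪z, p - w⟫ + c / ρ * ‖p - w‖) ≤ t * s := by nlinarith
    exact le_of_mul_le_mul_left h3 ht0
  filter_upwards [Metric.closedBall_mem_nhds z (show 0 < c / ρ by positivity)] with z' hz'
  rw [mem_closedBall, dist_eq_norm] at hz'
  refine conj_le hb fun p s hs => ?_
  have e : ⟪z', p⟫ = ⟪z', w⟫ + ⟪z, p - w⟫ + ⟪z' - z, p - w⟫ := by
    simp only [inner_sub_right, inner_sub_left]; ring
  have hcs := real_inner_le_norm (z' - z) (p - w)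
  rcases le_total ‖p - w‖ ρ with hp | hp
  · have h1 := hmin p s hs.le
    have h2 : ‖z' - z‖ * ‖p - w‖ ≤ ρ * ‖z' - z‖ := by
      rw [mul_comm]; exact mul_le_mul_of_nonneg_right hp (norm_nonneg _)
    linarith
  · have h1 := hfar p hp s hs.le
    have h2 : ‖z' - z‖ * ‖p - w‖ ≤ c / ρ * ‖p - w‖ :=
      mul_le_mul_of_nonneg_right hz' (norm_nonneg _)
    have h3 : 0 ≤ ρ * ‖z' - z‖ := by positivity
    linarith

theorem eventually_conj_ne_top {g : F → EReal} (hb : ∀ x, g x ≠ ⊥) (hg : ConvexFn g)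
    (hlsc : LowerSemicontinuous g) (hess : EssStrictConvexFn g) {w z : F}
    (hz : z ∈ subdiff g w) : ∀ᶠ z' in 𝓝 z, conj g z' ≠ ⊤ := by
  obtain ⟨r, hr⟩ := exists_real_of_ne_top hb hz.1
  filter_upwards [conj_le_of_essStrictConvex hb hg hlsc hess hr hz one_pos] with z' h
  exact ne_top_of_le_ne_top (EReal.coe_ne_top _) h

theorem conj_ne_bot {g : F → EReal} (hg : ProperFn g) (z : F) : conj g z ≠ ⊥ := by
  obtain ⟨x, hx⟩ := hg.2
  obtain ⟨r, hr⟩ := exists_real_of_ne_top hg.1 hx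
  exact ne_bot_of_le_ne_bot (EReal.coe_ne_bot _) (le_conj hr z)

/-- The conjugate of an essentially strictly convex function is differentiable at every
subgradient. -/
theorem hasFDerivAt_conj {g : F → EReal} (hg : ProperFn g) (hgc : ConvexFn g)
    (hlsc : LowerSemicontinuous g) (hess : EssStrictConvexFn g) {w z : F}
    (hz : z ∈ subdiff g w) :
    HasFDerivAt (fun z' => (conj g z').toReal) (innerSL ℝ w) z := by
  have hb := hg.1
  obtain ⟨r, hr⟩ := exists_real_of_ne_top hb hz.1
  rw [hasFDerivAt_iff_isLittleO, Asymptotics.isLittleO_iff]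
  intro ρ hρ
  filter_upwards [conj_le_of_essStrictConvex hb hgc hlsc hess hr hz hρ,
    eventually_conj_ne_top hb hgc hlsc hess hz] with z' h1 h2
  obtain ⟨a, ha⟩ := exists_real_of_ne_top (conj_ne_bot hg) h2
  have h3 := le_conj hr z'
  rw [ha, EReal.coe_le_coe_iff] at h1 h3
  rw [ha, conj_eq_of_mem_subdiff hb hr hz, EReal.toReal_coe, EReal.toReal_coe, innerSL_apply_apply,
    real_inner_comm (z' - z) w, inner_sub_left, Real.norm_eq_abs, abs_le]
  have : 0 ≤ ρ * ‖z' - z‖ := by positivity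
  constructor <;> linarith

end ConvexAnalysis

section KurdykaLojasiewicz

theorem summable_of_desingularization {M Δ : ℕ → ℝ} {Mb c C : ℝ} (hc : 0 < c)
    (hC : 0 < C) (hΔ : ∀ k, 0 ≤ Δ k) (hdesc : ∀ k, M (k + 1) + c * Δ (k + 1) ^ 2 ≤ M k)
    (hM : Tendsto M atTop (𝓝 Mb)) {ω ωd : ℝ → ℝ} {μ : ℝ} (hμ : 0 < μ)
    (hcont : ContinuousOn ω (Ico 0 μ)) (hconc : ConcaveOn ℝ (Ico 0 μ) ω)
    (hderiv : ∀ t ∈ Ioo 0 μ, HasDerivAt ω (ωd t) t ∧ 0 < ωd t) (hsmall : ∀ k, M k < Mb + μ)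
    (hKL : ∀ k, Mb < M k → 1 ≤ ωd (M k - Mb) * (C * Δ k)) : Summable Δ := by
  have hanti : Antitone M := antitone_nat_of_succ_le fun k => by
    have := hdesc k
    have : 0 ≤ c * Δ (k + 1) ^ 2 := by positivity
    linarith
  have hge : ∀ k, Mb ≤ M k := fun k => hanti.le_of_tendsto hM k
  by_cases hfin : ∃ k, M k = Mb
  · obtain ⟨k, hk⟩ := hfin
    have hz : ∀ j, Δ (j + (k + 1)) = 0 := by
      intro j
      have h1 := hdesc (j + k)
      have h2 := hanti (show k ≤ j + k by omega)
      have h3 := hge (j + k + 1)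
      have h4 : c * Δ (j + k + 1) ^ 2 ≤ 0 := by linarith
      have h5 : Δ (j + k + 1) ^ 2 = 0 := by
        have := sq_nonneg (Δ (j + k + 1))
        nlinarith
      exact pow_eq_zero_iff two_ne_zero |>.1 h5
    rw [← summable_nat_add_iff (k + 1)]
    simp only [hz]
    exact summable_zero
  push Not at hfin
  have hgt : ∀ k, Mb < M k := fun k => lt_of_le_of_ne (hge k) (Ne.symm (hfin k))
  set a : ℕ → ℝ := fun k => ω (M k - Mb) with ha
  have hmem : ∀ k, M k - Mb ∈ Ico 0 μ := fun k => ⟨by linarith [hgt k], by linarith [hsmall k]⟩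
  have hstep : ∀ k, 2 * Δ (k + 1) ≤ Δ k + C / c * (a k - a (k + 1)) := by
    intro k
    obtain ⟨hd, hpos⟩ := hderiv (M k - Mb) ⟨by linarith [hgt k], by linarith [hsmall k]⟩
    have h1 : ωd (M k - Mb) * (M k - M (k + 1)) ≤ a k - a (k + 1) := by
      rcases (hanti (Nat.le_succ k)).eq_or_lt with h | h
      · simp only [Nat.succ_eq_add_one] at h
        simp [ha, h]
      · have h2 := hconc.le_slope_of_hasDerivAt (hmem (k + 1)) (hmem k)
          (show M (k + 1) - Mb < M k - Mb by simpa using h) hd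
        rw [slope_def_field, le_div_iff₀ (by simpa using h)] at h2
        simpa using h2
    have h3 := hdesc k
    have h4 := hKL k (hgt k)
    have hD := hΔ k
    have h5 : c * Δ (k + 1) ^ 2 ≤ C * Δ k * (a k - a (k + 1)) := by
      calc c * Δ (k + 1) ^ 2 ≤ c * Δ (k + 1) ^ 2 * (ωd (M k - Mb) * (C * Δ k)) :=
            le_mul_of_one_le_right (by positivity) h4
        _ ≤ (M k - M (k + 1)) * (ωd (M k - Mb) * (C * Δ k)) :=
            mul_le_mul_of_nonneg_right (by linarith) (by positivity)
        _ = C * Δ k * (ωd (M k - Mb) * (M k - M (k + 1))) := by ring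
        _ ≤ _ := mul_le_mul_of_nonneg_left h1 (by positivity)
    have hb : 0 ≤ a k - a (k + 1) := by
      refine le_trans ?_ h1
      have := hanti (Nat.le_succ k)
      simp only [Nat.succ_eq_add_one] at this
      exact mul_nonneg hpos.le (by linarith)
    have h6 : Δ (k + 1) ^ 2 ≤ Δ k * (C / c * (a k - a (k + 1))) := by
      have : Δ k * (C / c * (a k - a (k + 1))) = (C * Δ k * (a k - a (k + 1))) / c := by
        field_simp
      rw [this, le_div_iff₀ hc]
      linarith
    have hb' : 0 ≤ C / c * (a k - a (k + 1)) := by positivity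
    nlinarith [sq_nonneg (Δ k - C / c * (a k - a (k + 1))), hΔ (k + 1)]
  have hlim : Tendsto a atTop (𝓝 (ω 0)) := by
    have h0 : ContinuousWithinAt ω (Ico 0 μ) 0 := hcont 0 ⟨le_rfl, hμ⟩
    refine h0.tendsto.comp (tendsto_nhdsWithin_iff.2 ⟨?_, Eventually.of_forall hmem⟩)
    simpa using hM.sub_const Mb
  obtain ⟨B, hB⟩ := hlim.bddBelow_range
  have hsum : ∀ n, ∑ k ∈ Finset.range n, Δ (k + 1) + Δ n ≤ Δ 0 + C / c * (a 0 - a n) := by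
    intro n
    induction n with
    | zero => simp
    | succ n ih =>
      rw [Finset.sum_range_succ]
      have := hstep n
      have e : C / c * (a 0 - a (n + 1)) = C / c * (a 0 - a n) + C / c * (a n - a (n + 1)) := by
        ring
      linarith
  rw [← summable_nat_add_iff 1]
  refine summable_of_sum_range_le (c := Δ 0 + C / c * (a 0 - B)) (fun k => hΔ _) fun n => ?_
  have h1 := hsum n
  have h2 : B ≤ a n := hB ⟨n, rfl⟩
  have h3 : C / c * (a 0 - a n) ≤ C / c * (a 0 - B) :=
    mul_le_mul_of_nonneg_left (by linarith) (by positivity)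
  linarith [hΔ n]

variable {X : Type*} [NormedAddCommGroup X] [InnerProductSpace ℝ X] [FiniteDimensional ℝ X]

/-- Uniformized Kurdyka–Łojasiewicz inequality along a bounded sequence. -/
theorem exists_uniform_KL {Φ : X → EReal} {q : ℕ → X} {M η : ℕ → ℝ} {Mb : ℝ}
    (hq : ∃ R, ∀ k, ‖q k‖ ≤ R) (hval : ∀ᶠ k in atTop, Φ (q k) = M k)
    (hsub : ∀ᶠ k in atTop, ∃ v ∈ frechetSubdiff Φ (q k), ‖v‖ ≤ η k)
    (hM : Tendsto M atTop (𝓝 Mb)) (hη : Tendsto η atTop (𝓝 0))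
    (hclus : ∀ ψ : ℕ → ℕ, StrictMono ψ → ∀ p, Tendsto (q ∘ ψ) atTop (𝓝 p) → Φ p = Mb)
    (hKL : ∀ p, (limitingSubdiff Φ p).Nonempty → KLAt Φ p) :
    ∃ μ : ℝ, 0 < μ ∧ ∃ ω ωd : ℝ → ℝ, ContinuousOn ω (Ico 0 μ) ∧ ConcaveOn ℝ (Ico 0 μ) ω ∧
      (∀ t ∈ Ioo 0 μ, HasDerivAt ω (ωd t) t ∧ 0 < ωd t) ∧
      ∀ᶠ k in atTop, Mb < M k → M k < Mb + μ → 1 ≤ ωd (M k - Mb) * η k := by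
  have hηnn : ∀ᶠ k in atTop, 0 ≤ η k := by
    filter_upwards [hsub] with k ⟨v, _, hv⟩ using (norm_nonneg v).trans hv
  obtain ⟨R, hR⟩ := hq
  suffices H : ∃ μ : ℝ, 0 < μ ∧ ∃ ω ωd : ℝ → ℝ, ContinuousOn ω (Ico 0 μ) ∧
      ConcaveOn ℝ (Ico 0 μ) ω ∧ (∀ t ∈ Ioo 0 μ, HasDerivAt ω (ωd t) t ∧ 0 < ωd t) ∧
      ∀ᶠ k in atTop, q k ∈ closedBall (0 : X) R → Mb < M k → M k < Mb + μ →
        1 ≤ ωd (M k - Mb) * η k by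
    obtain ⟨μ, hμ, ω, ωd, h1, h2, h3, h4⟩ := H
    exact ⟨μ, hμ, ω, ωd, h1, h2, h3, h4.mono fun k hk => hk (by simpa using hR k)⟩
  refine IsCompact.induction_on (p := fun s => ∃ μ : ℝ, 0 < μ ∧ ∃ ω ωd : ℝ → ℝ,
      ContinuousOn ω (Ico 0 μ) ∧
      ConcaveOn ℝ (Ico 0 μ) ω ∧ (∀ t ∈ Ioo 0 μ, HasDerivAt ω (ωd t) t ∧ 0 < ωd t) ∧
      ∀ᶠ k in atTop, q k ∈ s → Mb < M k → M k < Mb + μ →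
        1 ≤ ωd (M k - Mb) * η k) (isCompact_closedBall (0 : X) R) ?_ ?_ ?_ ?_
  · refine ⟨1, one_pos, fun t => t, fun _ => 1, continuousOn_id, concaveOn_id (convex_Ico 0 1),
      fun t _ => ⟨hasDerivAt_id t, one_pos⟩, Eventually.of_forall fun k hk => absurd hk ?_⟩
    exact notMem_empty _
  · rintro s t hst ⟨μ, hμ, ω, ωd, h1, h2, h3, h4⟩
    exact ⟨μ, hμ, ω, ωd, h1, h2, h3, h4.mono fun k hk h => hk (hst h)⟩
  · rintro s t ⟨μ, hμ, ω, ωd, h1, h2, h3, h4⟩ ⟨μ', hμ', ω', ωd', h1', h2', h3', h4'⟩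
    have hs : Ico 0 (min μ μ') ⊆ Ico 0 μ := Ico_subset_Ico_right (min_le_left _ _)
    have hs' : Ico 0 (min μ μ') ⊆ Ico 0 μ' := Ico_subset_Ico_right (min_le_right _ _)
    refine ⟨min μ μ', lt_min hμ hμ', fun t => ω t + ω' t, fun t => ωd t + ωd' t,
      (h1.mono hs).add (h1'.mono hs'),
      (h2.subset hs (convex_Ico _ _)).add (h2'.subset hs' (convex_Ico _ _)), fun t ht => ?_, ?_⟩
    · have hl := h3 t ⟨ht.1, ht.2.trans_le (min_le_left _ _)⟩
      have hr := h3' t ⟨ht.1, ht.2.trans_le (min_le_right _ _)⟩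
      exact ⟨hl.1.add hr.1, add_pos hl.2 hr.2⟩
    · filter_upwards [h4, h4', hηnn] with k hk hk' hn hkst hlt hltμ
      have hl := h3 (M k - Mb) ⟨by linarith, by linarith [min_le_left μ μ']⟩
      have hr := h3' (M k - Mb) ⟨by linarith, by linarith [min_le_right μ μ']⟩
      have hl' := mul_nonneg hl.2.le hn
      have hr' := mul_nonneg hr.2.le hn
      rw [add_mul]
      rcases hkst with h | h
      · have := hk h hlt (by linarith [min_le_left μ μ'])
        linarith
      · have := hk' h hlt (by linarith [min_le_right μ μ'])
        linarith
  · intro p _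
    by_cases hp : MapClusterPt p atTop q
    · obtain ⟨ψ, hψ, hlim⟩ := hp.tendsto_subseq
      have hΦp := hclus ψ hψ p hlim
      have hψt := hψ.tendsto_atTop
      have hzero : (0 : X) ∈ limitingSubdiff Φ p := by
        obtain ⟨N, hN⟩ := eventually_atTop.1 (hψt.eventually (hsub.and hval))
        choose! v hv hvn using fun k (hk : k ≥ N) => (hN k hk).1
        have hNt : Tendsto (fun k => k + N) atTop atTop := tendsto_add_atTop_nat N
        refine ⟨fun k => q (ψ (k + N)), fun k => v (k + N), hlim.comp hNt, ?_, ?_,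
          fun k => hv _ (by omega)⟩
        · rw [hΦp]
          have : (fun k => Φ (q (ψ (k + N)))) = fun k => ((M (ψ (k + N)) : ℝ) : EReal) := by
            funext k; exact (hN _ (by omega)).2
          rw [this]
          exact (continuous_coe_real_ereal.tendsto Mb).comp (hM.comp (hψt.comp hNt))
        · exact squeeze_zero_norm (fun k => hvn _ (by omega)) (hη.comp (hψt.comp hNt))
      obtain ⟨μ, hμ, U, hU, ω, ωd, h1, h2, -, h3, h4⟩ := hKL p ⟨0, hzero⟩
      refine ⟨U, mem_nhdsWithin_of_mem_nhds hU, μ, hμ, ω, ωd, h1, h2, h3, ?_⟩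
      filter_upwards [hval, hsub] with k hk ⟨v, hv, hvn⟩ hkU hlt hltμ
      have hvl : v ∈ limitingSubdiff Φ (q k) :=
        ⟨fun _ => q k, fun _ => v, tendsto_const_nhds, tendsto_const_nhds, tendsto_const_nhds,
          fun _ => hv⟩
      have := h4 (q k) hkU (by rw [hΦp, hk]; exact_mod_cast hlt)
        (by rw [hΦp, hk]; exact_mod_cast hltμ) v hvl
      rw [hΦp, hk, EReal.toReal_coe, EReal.toReal_coe] at this
      have hpos := (h3 (M k - Mb) ⟨by linarith, by linarith⟩).2
      exact this.trans (mul_le_mul_of_nonneg_left hvn hpos.le)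
    · rw [mapClusterPt_iff_frequently] at hp
      push Not at hp
      obtain ⟨t, ht, hev⟩ := hp
      refine ⟨t, mem_nhdsWithin_of_mem_nhds ht, 1, one_pos, fun t => t, fun _ => 1,
        continuousOn_id, concaveOn_id (convex_Ico 0 1), fun t _ => ⟨hasDerivAt_id t, one_pos⟩, ?_⟩
      filter_upwards [hev] with k hk hk' using absurd hk' hk

/-- Finite length of a descent sequence under the Kurdyka–Łojasiewicz property. -/
theorem summable_of_KL {Φ : X → EReal} {q : ℕ → X} {M Δ : ℕ → ℝ} {Mb c C : ℝ} (hc : 0 < c)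
    (hC : 0 < C) (hΔ : ∀ k, 0 ≤ Δ k)
    (hq : ∃ R, ∀ k, ‖q k‖ ≤ R) (hval : ∀ᶠ k in atTop, Φ (q k) = M k)
    (hsub : ∀ᶠ k in atTop, ∃ v ∈ frechetSubdiff Φ (q k), ‖v‖ ≤ C * Δ k)
    (hdesc : ∀ᶠ k in atTop, M (k + 1) + c * Δ (k + 1) ^ 2 ≤ M k)
    (hM : Tendsto M atTop (𝓝 Mb)) (hΔ0 : Tendsto Δ atTop (𝓝 0))
    (hclus : ∀ ψ : ℕ → ℕ, StrictMono ψ → ∀ p, Tendsto (q ∘ ψ) atTop (𝓝 p) → Φ p = Mb)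
    (hKL : ∀ p, (limitingSubdiff Φ p).Nonempty → KLAt Φ p) : Summable Δ := by
  obtain ⟨μ, hμ, ω, ωd, h1, h2, h3, h4⟩ := exists_uniform_KL hq hval hsub hM
    (by simpa using hΔ0.const_mul C) hclus hKL
  have hsmall : ∀ᶠ k in atTop, M k < Mb + μ := hM.eventually_lt_const (by linarith)
  obtain ⟨N, hN⟩ := eventually_atTop.1 (h4.and (hsmall.and hdesc))
  rw [← summable_nat_add_iff N]
  refine summable_of_desingularization (M := fun k => M (k + N)) hc hC (fun k => hΔ _)
    (fun k => ?_) ((tendsto_add_atTop_iff_nat N).2 hM) hμ h1 h2 h3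
    (fun k => (hN _ (by omega)).2.1) (fun k hk => (hN _ (by omega)).1 hk (hN _ (by omega)).2.1)
  have := (hN (k + N) (by omega)).2.2
  rwa [show k + 1 + N = k + N + 1 by omega]

end KurdykaLojasiewicz

section Smooth

/-- The real-valued version of `psi`, without the constraint. -/
def psiR (g : F → EReal) (h : E → ℝ) (A : E →L[ℝ] F) (δ γ : ℝ) (x : E) (z : F) (u : E) : ℝ :=
  ⟪z, A x⟫ + h x + δ / 2 * ‖x - u‖ ^ 2 - γ / 2 * ‖z‖ ^ 2 - (conj g z).toReal

theorem psi_eq_psiR {S : Set E} {g : F → EReal} (hg : ProperFn g) (h : E → ℝ) (A : E →L[ℝ] F)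
    (δ γ : ℝ) {x : E} {z : F} (u : E) (hx : x ∈ S) (hz : conj g z ≠ ⊤) :
    psi S g h A δ γ x z u = psiR g h A δ γ x z u := by
  obtain ⟨s, hs⟩ := exists_real_of_ne_top (conj_ne_bot hg) hz
  simp only [psi, psiR, indicatorFn, if_pos hx, hs, EReal.toReal_coe, add_zero]
  norm_cast

theorem psi_eq_top {S : Set E} {g : F → EReal} (hg : ProperFn g) (h : E → ℝ) (A : E →L[ℝ] F)
    (δ γ : ℝ) {x : E} {z : F} (u : E) (hx : x ∉ S) (hz : conj g z ≠ ⊤) :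
    psi S g h A δ γ x z u = ⊤ := by
  obtain ⟨s, hs⟩ := exists_real_of_ne_top (conj_ne_bot hg) hz
  simp only [psi, indicatorFn, if_neg hx, hs]
  rw [← EReal.coe_sub, EReal.coe_add_top]

theorem hasFDerivAt_psiR {X : Type*} [NormedAddCommGroup X] [NormedSpace ℝ X] {g : F → EReal}
    (hg : ProperFn g) (hgc : ConvexFn g) (hlsc : LowerSemicontinuous g)
    (hess : EssStrictConvexFn g) {h : E → ℝ} {gx : E} {A : E →L[ℝ] F} (δ : ℝ) {γ : ℝ}
    {px pu : X →L[ℝ] E} {pz : X →L[ℝ] F} {q : X} (hh : HasGradientAt h gx (px q))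
    (hz : pz q ∈ subdiff g (A (px q) - γ • pz q)) :
    HasFDerivAt (fun p => psiR g h A δ γ (px p) (pz p) (pu p))
      ((innerSL ℝ (ContinuousLinearMap.adjoint A (pz q) + gx + δ • (px q - pu q))).comp px
        - (innerSL ℝ (δ • (px q - pu q))).comp pu) q := by
  have h1 := pz.hasFDerivAt (x := q) |>.inner ℝ ((A.comp px).hasFDerivAt (x := q))
  have h2 := (hasGradientAt_iff_hasFDerivAt.1 hh).comp q (px.hasFDerivAt (x := q))
  have h3 := (((px - pu).hasFDerivAt (x := q)).norm_sq).const_mul (δ / 2)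
  have h4 := (pz.hasFDerivAt (x := q)).norm_sq.const_mul (γ / 2)
  have h5 := (hasFDerivAt_conj hg hgc hlsc hess hz).comp q (pz.hasFDerivAt (x := q))
  refine ((((h1.add h2).add h3).sub h4).sub h5).congr_fderiv ?_
  ext d
  simp only [ContinuousLinearMap.coe_comp, Function.comp_apply, _root_.add_apply,
    _root_.sub_apply, _root_.smul_apply, innerSL_apply_apply,
    fderivInnerCLM_apply, ContinuousLinearMap.prod_apply, InnerProductSpace.toDual_apply_apply,
    smul_eq_mul, inner_add_left, inner_sub_left, inner_smul_left, inner_sub_right,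
    ContinuousLinearMap.adjoint_inner_left, nsmul_eq_mul]
  rw [real_inner_comm (A (px q)) (pz d)]
  simp
  ring

/-- A lower ratio model with a normal direction produces a Fréchet subgradient. -/
theorem exists_frechetSubdiff_of_ratio {X : Type*} [NormedAddCommGroup X] [InnerProductSpace ℝ X]
    [FiniteDimensional ℝ X] {Φ : X → EReal} {q : X} {N D : X → ℝ} {LN LD ν : X →L[ℝ] ℝ}
    {B : ℝ} (hB : 0 ≤ B) (hN : HasFDerivAt N LN q) (hD : HasFDerivAt D LD q) (hD0 : 0 < D q)
    (hq : Φ q = ((N q / D q : ℝ) : EReal))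
    (hmin : ∀ᶠ p in 𝓝 q, Φ p = ⊤ ∨ (((N p / D p : ℝ) : EReal) ≤ Φ p ∧ ν (p - q) ≤ 0))
    (hbound : ∀ d, |LN d + ν d - N q / D q * LD d| ≤ B * D q * ‖d‖) :
    ∃ v ∈ frechetSubdiff Φ q, ‖v‖ ≤ B := by
  have hI := (hasDerivAt_inv hD0.ne').comp_hasFDerivAt q hD
  have hG := hN.mul hI
  set LG := N q • (-(D q ^ 2)⁻¹ • LD) + (Inv.inv ∘ D) q • LN with hLG
  have hGv : ∀ p, (N * (Inv.inv ∘ D)) p = N p / D p := fun p => by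
    simp [div_eq_mul_inv]
  refine ⟨(InnerProductSpace.toDual ℝ X).symm (LG + (D q)⁻¹ • ν), ⟨?_, fun ε hε => ?_⟩, ?_⟩
  · rw [hq]; exact EReal.coe_ne_top _
  · have hlo := (Asymptotics.isLittleO_iff.1 (hasFDerivAt_iff_isLittleO.1 hG)) hε
    filter_upwards [hlo, hmin] with p hp hp'
    rcases hp' with htop | ⟨hle, hν⟩
    · rw [htop]; exact le_top
    refine le_trans ?_ hle
    rw [hq, ← EReal.coe_add, EReal.coe_le_coe_iff, InnerProductSpace.toDual_symm_apply]
    rw [hGv, hGv, Real.norm_eq_abs] at hp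
    have h1 := neg_le_of_abs_le hp
    have h2 : (LG + (D q)⁻¹ • ν) (p - q) = LG (p - q) + (D q)⁻¹ * ν (p - q) := by simp
    have h3 : (D q)⁻¹ * ν (p - q) ≤ 0 :=
      mul_nonpos_of_nonneg_of_nonpos (inv_nonneg.2 hD0.le) hν
    rw [h2]
    linarith
  · rw [LinearIsometryEquiv.norm_map]
    refine ContinuousLinearMap.opNorm_le_bound _ hB fun d => ?_
    have e : (LG + (D q)⁻¹ • ν) d = (LN d + ν d - N q / D q * LD d) / D q := by
      simp only [hLG, _root_.add_apply, _root_.smul_apply, smul_eq_mul,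
        Function.comp_apply]
      field_simp
      ring
    rw [e, Real.norm_eq_abs, abs_div, abs_of_pos hD0, div_le_iff₀ hD0]
    linarith [hbound d]

theorem le_add_inner_add_sq_of_lipschitz_gradient {S O : Set E} {h : E → ℝ} {h' : E → E} {L : ℝ}
    (hS : Convex ℝ S) (hSO : S ⊆ O) (hgrad : ∀ x ∈ O, HasGradientAt h (h' x) x)
    (hlip : ∀ x ∈ O, ∀ y ∈ O, ‖h' x - h' y‖ ≤ L * ‖x - y‖) {a b : E} (ha : a ∈ S) (hb : b ∈ S) :
    h b ≤ h a + ⟪h' a, b - a⟫ + L / 2 * ‖b - a‖ ^ 2 := by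
  set d := b - a with hd
  have hmem : ∀ t ∈ Icc (0 : ℝ) 1, a + t • d ∈ O := fun t ht =>
    hSO (hS.add_smul_sub_mem ha hb ht)
  set r : ℝ → ℝ := fun t => h (a + t • d) - t * ⟪h' a, d⟫ - L / 2 * t ^ 2 * ‖d‖ ^ 2 with hr
  have hder : ∀ t ∈ Icc (0 : ℝ) 1,
      HasDerivAt r (⟪h' (a + t • d), d⟫ - ⟪h' a, d⟫ - L * t * ‖d‖ ^ 2) t := by
    intro t ht
    have h1 := hasGradientAt_iff_hasFDerivAt.1 (hgrad _ (hmem t ht))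
    have h2 : HasDerivAt (fun t : ℝ => a + t • d) d t := by
      simpa using ((hasDerivAt_id t).smul_const d).const_add a
    have h3 := h1.comp_hasDerivAt t h2
    have h4 := (hasDerivAt_id t).mul_const ⟪h' a, d⟫
    have h5 := (((hasDerivAt_id t).pow 2).const_mul (L / 2)).mul_const (‖d‖ ^ 2)
    refine ((h3.sub h4).sub h5).congr_deriv ?_
    simp only [InnerProductSpace.toDual_apply_apply, id_eq, Nat.cast_ofNat]
    ring
  have hanti : AntitoneOn r (Icc 0 1) := by
    refine antitoneOn_of_deriv_nonpos (convex_Icc 0 1)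
      (fun t ht => (hder t ht).continuousAt.continuousWithinAt)
      (fun t ht => (hder t (interior_subset ht)).differentiableAt.differentiableWithinAt)
      fun t ht => ?_
    have ht' := interior_subset ht
    rw [(hder t ht').deriv, ← inner_sub_left]
    have h1 := real_inner_le_norm (h' (a + t • d) - h' a) d
    have h2 := hlip _ (hmem t ht') a (hSO ha)
    rw [add_sub_cancel_left, norm_smul, Real.norm_of_nonneg ht'.1] at h2
    nlinarith [norm_nonneg d, mul_le_mul_of_nonneg_right h2 (norm_nonneg d)]
  have := hanti ⟨le_rfl, zero_le_one⟩ ⟨zero_le_one, le_rfl⟩ zero_le_one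
  simp only [hr, hd] at this
  simp only [one_smul, add_sub_cancel, zero_smul, add_zero] at this
  simp only [hd]
  linarith

theorem inner_nonneg_of_isMinOn {S : Set E} (hS : Convex ℝ S) {p u c : E} {δ : ℝ} (hc : c ∈ S)
    (hmin : ∀ w ∈ S, ⟪p, c⟫ + δ / 2 * ‖c - u‖ ^ 2 ≤ ⟪p, w⟫ + δ / 2 * ‖w - u‖ ^ 2) {w : E}
    (hw : w ∈ S) : 0 ≤ ⟪p + δ • (c - u), w - c⟫ := by
  have key : ∀ t ∈ Ioo (0 : ℝ) 1,
      0 ≤ ⟪p + δ • (c - u), w - c⟫ + t * (δ / 2 * ‖w - c‖ ^ 2) := by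
    intro t ht
    have h1 := hmin _ (hS.add_smul_sub_mem hc hw ⟨ht.1.le, ht.2.le⟩)
    have h2 : c + t • (w - c) - u = (c - u) + t • (w - c) := by abel
    rw [h2, norm_add_sq_real, inner_add_right, inner_smul_right, inner_smul_right, norm_smul,
      mul_pow, Real.norm_eq_abs, sq_abs] at h1
    rw [inner_add_left, inner_smul_left]
    simp only [conj_trivial]
    have h3 : 0 ≤ t * (⟪p, w - c⟫ + δ * ⟪c - u, w - c⟫ + t * (δ / 2 * ‖w - c‖ ^ 2)) := by
      nlinarith
    exact nonneg_of_mul_nonneg_right h3 ht.1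
  have hlim : Tendsto (fun t : ℝ => ⟪p + δ • (c - u), w - c⟫ + t * (δ / 2 * ‖w - c‖ ^ 2))
      (𝓝[>] 0) (𝓝 (⟪p + δ • (c - u), w - c⟫ + 0 * (δ / 2 * ‖w - c‖ ^ 2))) := by
    apply Tendsto.mono_left _ nhdsWithin_le_nhds
    exact Continuous.tendsto (by fun_prop) _
  rw [zero_mul, add_zero] at hlim
  refine ge_of_tendsto hlim ?_
  filter_upwards [Ioo_mem_nhdsGT (zero_lt_one' ℝ)] with t ht using key t ht

theorem exists_subgradient_bound {f : G → EReal} (hb : ∀ x, f x ≠ ⊥) (hf : ConvexFn f)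
    {T : Set G} (hT : IsCompact T) (hTf : T ⊆ interior (edom f)) :
    ∃ B : ℝ, 0 ≤ B ∧ ∀ w ∈ T, ∀ v ∈ subdiff f w, ‖v‖ ≤ B := by
  obtain ⟨r, hr, hrT⟩ := hT.exists_cthickening_subset_open isOpen_interior hTf
  have hcont : ContinuousOn (fun x => (f x).toReal) (cthickening r T) := fun x hx =>
    (hf.continuousAt_toReal hb (hrT hx)).continuousWithinAt
  obtain ⟨C, hC⟩ := hT.cthickening.exists_bound_of_continuousOn hcont
  refine ⟨2 * |C| / r, by positivity, fun w hw v hv => ?_⟩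
  rcases eq_or_ne v 0 with rfl | hv0
  · rw [norm_zero]; positivity
  have hvn : 0 < ‖v‖ := norm_pos_iff.2 hv0
  have hy : w + (r / ‖v‖) • v ∈ cthickening r T := by
    refine mem_cthickening_of_dist_le _ w r T hw ?_
    rw [dist_eq_norm, add_sub_cancel_left, norm_smul, Real.norm_of_nonneg (by positivity),
      div_mul_cancel₀ _ hvn.ne']
  have h1 := hC _ hy
  have h2 := hC _ (self_subset_cthickening T hw)
  rw [Real.norm_eq_abs] at h1 h2
  have hfy := EReal.coe_toReal (x := f (w + (r / ‖v‖) • v)) (interior_subset (hrT hy)) (hb _)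
  have hfw := EReal.coe_toReal (x := f w) (interior_subset (hTf hw)) (hb _)
  have h3 := (mem_subdiff_iff hfw.symm).1 hv _ _ hfy.ge
  rw [add_sub_cancel_left, inner_smul_right, real_inner_self_eq_norm_sq] at h3
  have h4 : r / ‖v‖ * ‖v‖ ^ 2 = r * ‖v‖ := by field_simp
  rw [h4] at h3
  rw [le_div_iff₀ hr]
  have := (abs_le.1 h1).2
  have := (abs_le.1 h2).1
  have := le_abs_self C
  linarith

theorem exists_lipschitz_of_isCompact {g : F → EReal} (hb : ∀ x, g x ≠ ⊥) (hg : ConvexFn g)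
    {T : Set F} (hT : IsCompact T) (hTg : T ⊆ interior (edom g)) :
    ∃ κ : ℝ, 0 < κ ∧ ∀ a ∈ T, ∀ b ∈ T, g a ≤ g b + ((κ * ‖a - b‖ : ℝ) : EReal) := by
  have hl := ((hg.convexOn_toReal hb).locallyLipschitzOn_interior).mono hTg
  obtain ⟨κ, hκ⟩ := hl.exists_lipschitzOnWith_of_compact hT
  refine ⟨κ + 1, by positivity, fun a ha b hb' => ?_⟩
  have h1 := hκ.dist_le_mul a ha b hb'
  rw [Real.dist_eq, dist_eq_norm] at h1
  have hga := EReal.coe_toReal (x := g a) (interior_subset (hTg ha)) (hb _)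
  have hgb := EReal.coe_toReal (x := g b) (interior_subset (hTg hb')) (hb _)
  rw [← hga, ← hgb, ← EReal.coe_add, EReal.coe_le_coe_iff]
  have := (abs_le.1 h1).2
  nlinarith [norm_nonneg (a - b)]

theorem mem_subdiff_of_tendsto {f : E → EReal} (hb : ∀ x, f x ≠ ⊥) (hlsc : LowerSemicontinuous f)
    (hdom : ∃ x, f x ≠ ⊤) {w v : ℕ → E} {wl vl : E} (hv : ∀ k, v k ∈ subdiff f (w k))
    (hwl : Tendsto w atTop (𝓝 wl)) (hvl : Tendsto v atTop (𝓝 vl)) : vl ∈ subdiff f wl := by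
  have key : ∀ y, ∀ s : ℝ, f y ≤ s → f wl ≤ ((s - ⟪vl, y - wl⟫ : ℝ) : EReal) := by
    intro y s hs
    refine le_of_forall_lt fun c hc => ?_
    obtain ⟨c', hcc', hc'⟩ := EReal.lt_iff_exists_real_btwn.1 hc
    refine hcc'.trans_le ?_
    rw [EReal.coe_le_coe_iff]
    have hlim : Tendsto (fun k => s - ⟪v k, y - w k⟫) atTop (𝓝 (s - ⟪vl, y - wl⟫)) :=
      tendsto_const_nhds.sub (hvl.inner (tendsto_const_nhds.sub hwl))
    refine ge_of_tendsto hlim ?_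
    filter_upwards [hwl.eventually (hlsc wl c' hc')] with k hk
    obtain ⟨r, hr⟩ := exists_real_of_ne_top hb (hv k).1
    rw [hr, gt_iff_lt, EReal.coe_lt_coe_iff] at hk
    have := (mem_subdiff_iff hr).1 (hv k) y s hs
    linarith
  obtain ⟨x, hx⟩ := hdom
  obtain ⟨s, hs⟩ := exists_real_of_ne_top hb hx
  obtain ⟨r, hr⟩ := exists_real_of_ne_top hb
    (ne_top_of_le_ne_top (EReal.coe_ne_top _) (key x s hs.le))
  refine (mem_subdiff_iff hr).2 fun y s' hs' => ?_
  have := key y s' hs'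
  rw [hr, EReal.coe_le_coe_iff] at this
  linarith

end Smooth

section Iteration

theorem conj_ne_top_of_mem_subdiff {g : F → EReal} (hb : ∀ x, g x ≠ ⊥) {w z : F}
    (hz : z ∈ subdiff g w) : conj g z ≠ ⊤ := by
  obtain ⟨r, hr⟩ := exists_real_of_ne_top hb hz.1
  rw [conj_eq_of_mem_subdiff hb hr hz]
  exact EReal.coe_ne_top _

theorem conj_toReal_add_inner_le {g : F → EReal} (hg : ProperFn g) {w z z' : F}
    (hz : z ∈ subdiff g w) (hz' : conj g z' ≠ ⊤) :
    (conj g z).toReal + ⟪w, z' - z⟫ ≤ (conj g z').toReal := by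
  obtain ⟨r, hr⟩ := exists_real_of_ne_top hg.1 hz.1
  obtain ⟨s, hs⟩ := exists_real_of_ne_top (conj_ne_bot hg) hz'
  have h1 := le_conj hr z'
  rw [hs, EReal.coe_le_coe_iff] at h1
  rw [conj_eq_of_mem_subdiff hg.1 hr hz, hs, EReal.toReal_coe, EReal.toReal_coe, inner_sub_right,
    real_inner_comm z' w, real_inner_comm z w]
  linarith

variable {S O : Set E} {g : F → EReal} {h : E → ℝ} {h' : E → E} {Lh : ℝ} {f : G → EReal}
  {A : E →L[ℝ] F} {K : E →L[ℝ] G} {γ ν β δ m : ℝ} {x u : ℕ → E} {y : ℕ → G} {z : ℕ → F}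
  {θ : ℕ → ℝ}

theorem mul_norm_sub_le_of_mem_subdiff (hg : ProperFn g) {a a' : E} {b b' : F}
    (hb : b ∈ subdiff g (A a - γ • b)) (hb' : b' ∈ subdiff g (A a' - γ • b')) :
    γ * ‖b' - b‖ ≤ ‖A‖ * ‖a' - a‖ := by
  have h1 := conj_toReal_add_inner_le hg hb (conj_ne_top_of_mem_subdiff hg.1 hb')
  have h2 := conj_toReal_add_inner_le hg hb' (conj_ne_top_of_mem_subdiff hg.1 hb)
  have h3 : γ * ‖b' - b‖ ^ 2 ≤ ⟪A (a' - a), b' - b⟫ := by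
    have e : ⟪A a - γ • b, b' - b⟫ + ⟪A a' - γ • b', b - b'⟫
        = γ * ‖b' - b‖ ^ 2 - ⟪A (a' - a), b' - b⟫ := by
      rw [← real_inner_self_eq_norm_sq]
      simp only [map_sub, inner_sub_left, inner_sub_right, inner_smul_left, conj_trivial]
      ring
    linarith
  have h4 := (real_inner_le_norm (A (a' - a)) (b' - b)).trans
    (mul_le_mul_of_nonneg_right (A.le_opNorm (a' - a)) (norm_nonneg _))
  rcases eq_or_lt_of_le (norm_nonneg (b' - b)) with h0 | h0
  · rw [← h0]; simp; positivity
  · refine le_of_mul_le_mul_right ?_ h0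
    nlinarith

/-- Moving both the primal and the dual variable changes the coupling term by at most the change
of the linear part, up to a negative square. -/
theorem coupling_sub_le (hg : ProperFn g) {a a' : E} {b b' : F}
    (hb : b ∈ subdiff g (A a - γ • b)) (hb' : b' ∈ subdiff g (A a' - γ • b')) :
    (⟪b', A a'⟫ - γ / 2 * ‖b'‖ ^ 2 - (conj g b').toReal)
        - (⟪b, A a'⟫ - γ / 2 * ‖b‖ ^ 2 - (conj g b).toReal)
      ≤ ⟪b' - b, A (a' - a)⟫ - γ / 2 * ‖b' - b‖ ^ 2 := by
  have h1 := conj_toReal_add_inner_le hg hb (conj_ne_top_of_mem_subdiff hg.1 hb')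
  have e : ⟪b' - b, A (a' - a)⟫ - γ / 2 * ‖b' - b‖ ^ 2 =
      ⟪b', A a'⟫ - γ / 2 * ‖b'‖ ^ 2 - (⟪b, A a'⟫ - γ / 2 * ‖b‖ ^ 2)
        - ⟪A a - γ • b, b' - b⟫ := by
    simp only [← real_inner_self_eq_norm_sq, map_sub, inner_sub_left, inner_sub_right,
      inner_smul_left, conj_trivial, real_inner_comm b' b, real_inner_comm b (A a),
      real_inner_comm b' (A a)]
    ring
  linarith

/-- The iterates of the algorithm, described by real inequalities. -/
structure Iterates (S O : Set E) (g : F → EReal) (h : E → ℝ) (h' : E → E) (Lh : ℝ)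
    (f : G → EReal) (A : E →L[ℝ] F) (K : E →L[ℝ] G) (γ ν β δ m : ℝ) (x u : ℕ → E) (y : ℕ → G)
    (z : ℕ → F) (θ : ℕ → ℝ) : Prop where
  convex : Convex ℝ S
  isCompact : IsCompact S
  g_proper : ProperFn g
  g_convex : ConvexFn g
  g_lsc : LowerSemicontinuous g
  g_ess : EssStrictConvexFn g
  f_proper : ProperFn f
  f_convex : ConvexFn f
  f_lsc : LowerSemicontinuous f
  subset : S ⊆ O
  h_grad : ∀ a ∈ O, HasGradientAt h (h' a) a
  h_lip : ∀ a ∈ O, ∀ b ∈ O, ‖h' a - h' b‖ ≤ Lh * ‖a - b‖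
  Lh_nonneg : 0 ≤ Lh
  K_mem : ∀ a ∈ S, K a ∈ interior (edom f)
  γ_pos : 0 < γ
  ν_pos : 0 < ν
  β_mem : β ∈ Ioo (0 : ℝ) 2
  m_pos : 0 < m
  δ_eq : δ = 2 * ν + Lh + 2 * ‖A‖ ^ 2 / γ
  le_f : ∀ a ∈ S, m ≤ (f (K a)).toReal
  x_mem : ∀ k, x k ∈ S
  z_mem : ∀ k, z k ∈ subdiff g (A (x k) - γ • z k)
  θ_pos : ∀ k, 0 < θ k
  θ_mul : ∀ k, θ k * (f (K (x k))).toReal = psiR g h A δ γ (x k) (z k) (u k)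
  y_mem : ∀ k, y (k + 1) ∈ subdiff f (K (x k))
  inner_nonneg : ∀ k, ∀ w ∈ S, 0 ≤ ⟪ContinuousLinearMap.adjoint A (z k)
    - θ k • ContinuousLinearMap.adjoint K (y (k + 1)) + h' (x k) + δ • (x (k + 1) - u k),
    w - x (k + 1)⟫
  u_succ : ∀ k, u (k + 1) = (1 - β) • u k + β • x (k + 1)

theorem IsAlgoSeq.iterates (hA1 : Assumption1 S g h h' Lh f A K) (hA2 : Assumption2 S g A)
    (hLh : 0 ≤ Lh) (hγ : 0 < γ) (hν : 0 < ν) (hβ : β ∈ Ioo (0 : ℝ) 2)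
    (hδ : δ = 2 * ν + Lh + 2 * ‖A‖ ^ 2 / γ) (halg : IsAlgoSeq S g h h' f A K γ δ β x u y z θ)
    (hess : EssStrictConvexFn g) (hm : 0 < m) (hmb : ∀ a ∈ S, (m : EReal) ≤ f (K a)) :
    ∃ O, Iterates S O g h h' Lh f A K γ ν β δ m x u y z θ := by
  obtain ⟨-, hS, hSc, hgp, hgc, hgl, ⟨O, -, hSO, hgr, hlip⟩, hfp, hfc, hfl, hK, -, -, -⟩ := hA1
  obtain ⟨hx0, hz, hθ, hy, hx, hu⟩ := halg
  have hxm : ∀ k, x k ∈ S := fun k => by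
    cases k with
    | zero => exact hx0
    | succ k => exact (hx k).1
  obtain ⟨v₀, hv₀⟩ := hA2.1 _ hx0
  have hzm : ∀ k, z k ∈ subdiff g (A (x k) - γ • z k) := fun k =>
    mem_subdiff_of_prox_conj hgp.1 hgc hgl hv₀ hγ (hz k)
  have hfK : ∀ a ∈ S, f (K a) = (f (K a)).toReal := fun a ha =>
    (EReal.coe_toReal (interior_subset (hK a ha)) (hfp.1 _)).symm
  refine ⟨O, ⟨hS, hSc, hgp, hgc, hgl, hess, hfp, hfc, hfl, hSO, hgr, hlip, hLh, hK, hγ, hν, hβ, hm,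
    hδ, fun a ha => ?_, hxm, hzm, fun k => (hθ k).1, fun k => ?_, hy, fun k w hw => ?_, hu⟩⟩
  · rw [← EReal.coe_le_coe_iff, ← hfK a ha]
    exact hmb a ha
  · have h1 := (hθ k).2
    rw [psi_eq_psiR hgp h A δ γ (u k) (hxm k) (conj_ne_top_of_mem_subdiff hgp.1 (hzm k)),
      hfK _ (hxm k), ← EReal.coe_mul, EReal.coe_eq_coe_iff] at h1
    exact h1
  · refine inner_nonneg_of_isMinOn hS (hx k).1 (fun w hw => ?_) hw
    have e : ∀ w, ⟪ContinuousLinearMap.adjoint A (z k)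
        - θ k • ContinuousLinearMap.adjoint K (y (k + 1)) + h' (x k), w⟫
        = ⟪z k, A w⟫ - θ k * ⟪K w, y (k + 1)⟫ + ⟪h' (x k), w⟫ := fun w => by
      simp only [inner_add_left, inner_sub_left, inner_smul_left, conj_trivial,
        ContinuousLinearMap.adjoint_inner_left, real_inner_comm (K w)]
    rw [e, e]
    exact (hx k).2 w hw

/-- The linearised denominator. -/
def linDen (f : G → EReal) (K : E →L[ℝ] G) (x : ℕ → E) (y : ℕ → G) (k : ℕ) : ℝ :=
  (f (K (x k))).toReal + ⟪K (x (k + 1) - x k), y (k + 1)⟫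

/-- The length of a step of the algorithm. -/
def stepLen (x u : ℕ → E) (k : ℕ) : ℝ := ‖x k - x (k + 1)‖ + ‖u k - u (k + 1)‖

/-- The ratio with linearised denominator. -/
def linRatio (g : F → EReal) (h : E → ℝ) (f : G → EReal) (A : E →L[ℝ] F) (K : E →L[ℝ] G)
    (δ γ : ℝ) (x u : ℕ → E) (y : ℕ → G) (z : ℕ → F) (k : ℕ) : ℝ :=
  psiR g h A δ γ (x (k + 1)) (z (k + 1)) (u (k + 1)) / linDen f K x y k

namespace Iterates

variable (H : Iterates S O g h h' Lh f A K γ ν β δ m x u y z θ)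

theorem stepLen_nonneg (x u : ℕ → E) (k : ℕ) : 0 ≤ stepLen x u k := by
  unfold stepLen; positivity

include H

theorem f_eq {a : E} (ha : a ∈ S) : f (K a) = (f (K a)).toReal :=
  (EReal.coe_toReal (interior_subset (H.K_mem a ha)) (H.f_proper.1 _)).symm

theorem δ_pos : 0 < δ := by
  have := H.Lh_nonneg
  have := H.ν_pos
  have := H.γ_pos
  rw [H.δ_eq]
  positivity

theorem norm_u_sub (k : ℕ) : ‖u k - u (k + 1)‖ = β * ‖x (k + 1) - u k‖ := by
  have e : u k - u (k + 1) = (-β) • (x (k + 1) - u k) := by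
    rw [H.u_succ k]; module
  rw [e, norm_smul, norm_neg, Real.norm_of_nonneg H.β_mem.1.le]

theorem x_sub_u_succ (k : ℕ) : x (k + 1) - u (k + 1) = (1 - β) • (x (k + 1) - u k) := by
  rw [H.u_succ k]; module

theorem norm_x_sub_u_succ_le (k : ℕ) : ‖x (k + 1) - u (k + 1)‖ ≤ β⁻¹ * stepLen x u k := by
  have hβ := H.β_mem
  rw [H.x_sub_u_succ, norm_smul, Real.norm_eq_abs]
  have h1 : |1 - β| ≤ 1 := abs_le.2 ⟨by linarith [hβ.2], by linarith [hβ.1]⟩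
  have h2 : ‖x (k + 1) - u k‖ ≤ β⁻¹ * stepLen x u k := by
    rw [inv_mul_eq_div, le_div_iff₀ hβ.1, stepLen, H.norm_u_sub]
    linarith [norm_nonneg (x k - x (k + 1))]
  exact (mul_le_of_le_one_left (norm_nonneg _) h1).trans h2

theorem psi_pos (k : ℕ) : 0 < psiR g h A δ γ (x k) (z k) (u k) := by
  rw [← H.θ_mul]
  exact mul_pos (H.θ_pos k) (H.m_pos.trans_le (H.le_f _ (H.x_mem k)))

theorem psi_succ_le (k : ℕ) :
    psiR g h A δ γ (x (k + 1)) (z (k + 1)) (u (k + 1)) + (ν * ‖x k - x (k + 1)‖ ^ 2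
      + δ * (2 - β) / (2 * β) * ‖u k - u (k + 1)‖ ^ 2) ≤ θ k * linDen f K x y k := by
  have h1 := coupling_sub_le H.g_proper (H.z_mem k) (H.z_mem (k + 1))
  have h2 := le_add_inner_add_sq_of_lipschitz_gradient H.convex H.subset H.h_grad H.h_lip
    (H.x_mem k) (H.x_mem (k + 1))
  have h3 := H.inner_nonneg k _ (H.x_mem k)
  have h4 : δ / 2 * ‖x (k + 1) - u (k + 1)‖ ^ 2 = δ / 2 * ‖x (k + 1) - u k‖ ^ 2
      - δ * (2 - β) / (2 * β) * ‖u k - u (k + 1)‖ ^ 2 := by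
    have hβ := H.β_mem.1
    rw [H.norm_u_sub, H.x_sub_u_succ, norm_smul, Real.norm_eq_abs, mul_pow, sq_abs]
    field_simp
    ring
  have h5 : ⟪z (k + 1) - z k, A (x (k + 1) - x k)⟫ - γ / 2 * ‖z (k + 1) - z k‖ ^ 2
      ≤ ‖A‖ ^ 2 / γ * ‖x (k + 1) - x k‖ ^ 2 / 2 := by
    have hγ := H.γ_pos
    have h6 := (real_inner_le_norm (z (k + 1) - z k) (A (x (k + 1) - x k))).trans
      (mul_le_mul_of_nonneg_left (A.le_opNorm (x (k + 1) - x k)) (norm_nonneg _))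
    have h7 : ‖A‖ ^ 2 / γ * ‖x (k + 1) - x k‖ ^ 2 / 2
        - (‖z (k + 1) - z k‖ * (‖A‖ * ‖x (k + 1) - x k‖) - γ / 2 * ‖z (k + 1) - z k‖ ^ 2)
        = (‖A‖ * ‖x (k + 1) - x k‖ - γ * ‖z (k + 1) - z k‖) ^ 2 / (2 * γ) := by
      field_simp
      ring
    have h8 : 0 ≤ (‖A‖ * ‖x (k + 1) - x k‖ - γ * ‖z (k + 1) - z k‖) ^ 2 / (2 * γ) := by
      positivity
    linarith
  have h9 : ⟪x (k + 1) - u k, x k - x (k + 1)⟫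
      = (‖x k - u k‖ ^ 2 - ‖x (k + 1) - u k‖ ^ 2 - ‖x (k + 1) - x k‖ ^ 2) / 2 := by
    have e : x k - u k = (x (k + 1) - u k) + (x k - x (k + 1)) := by abel
    rw [e, norm_add_sq_real, norm_sub_rev (x k)]
    ring
  have h10 := H.θ_mul k
  have h11 : 0 ≤ ‖A‖ ^ 2 / γ * ‖x (k + 1) - x k‖ ^ 2 := by
    have := H.γ_pos
    positivity
  have h12 : δ / 2 * ‖x (k + 1) - x k‖ ^ 2 = ν * ‖x (k + 1) - x k‖ ^ 2
      + Lh / 2 * ‖x (k + 1) - x k‖ ^ 2 + ‖A‖ ^ 2 / γ * ‖x (k + 1) - x k‖ ^ 2 := by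
    rw [H.δ_eq]; ring
  simp only [inner_add_left, inner_sub_left, inner_smul_left, conj_trivial,
    ContinuousLinearMap.adjoint_inner_left] at h3
  rw [← inner_sub_left, h9] at h3
  rw [linDen, mul_add, h10, norm_sub_rev (x k) (x (k + 1))]
  simp only [psiR, real_inner_comm (y (k + 1)) (K _)] at h3 ⊢
  simp only [map_sub, inner_sub_left, inner_sub_right] at h1 h2 h3 h5 ⊢
  nlinarith

theorem linDen_le (k : ℕ) : linDen f K x y k ≤ (f (K (x (k + 1)))).toReal := by
  have h1 := (mem_subdiff_iff (H.f_eq (H.x_mem k))).1 (H.y_mem k) _ _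
    (H.f_eq (H.x_mem (k + 1))).le
  rwa [real_inner_comm, ← map_sub] at h1

theorem linDen_pos (k : ℕ) : 0 < linDen f K x y k := by
  have h1 := H.psi_succ_le k
  have h2 := H.psi_pos (k + 1)
  have hδ := H.δ_pos
  have hν := H.ν_pos
  obtain ⟨hβ, hβ'⟩ := H.β_mem
  have h3 : 0 ≤ δ * (2 - β) / (2 * β) :=
    div_nonneg (mul_nonneg hδ.le (by linarith)) (by linarith)
  have h4 : 0 < θ k * linDen f K x y k := by
    refine lt_of_lt_of_le ?_ h1
    positivity
  exact pos_of_mul_pos_right h4 (H.θ_pos k).le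

theorem continuousOn_f : ContinuousOn (fun a => (f (K a)).toReal) S := fun a ha =>
  ((H.f_convex.continuousAt_toReal H.f_proper.1 (H.K_mem a ha)).comp
    K.continuous.continuousAt).continuousWithinAt

theorem θ_succ_le_linRatio (k : ℕ) : θ (k + 1) ≤ linRatio g h f A K δ γ x u y z k := by
  rw [linRatio, le_div_iff₀ (H.linDen_pos k), ← H.θ_mul]
  exact mul_le_mul_of_nonneg_left (H.linDen_le k) (H.θ_pos _).le

theorem exists_linRatio_add_le :
    ∃ c : ℝ, 0 < c ∧ ∀ k, linRatio g h f A K δ γ x u y z k + c * stepLen x u k ^ 2 ≤ θ k := by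
  obtain ⟨B, hB⟩ := H.isCompact.exists_bound_of_continuousOn H.continuousOn_f
  have hB0 : 0 < B := by
    have := (le_abs_self _).trans (hB _ (H.x_mem 0))
    linarith [H.m_pos, H.le_f _ (H.x_mem 0)]
  have hδ := H.δ_pos
  have hν := H.ν_pos
  obtain ⟨hβ, hβ'⟩ := H.β_mem
  have hc : 0 < δ * (2 - β) / (2 * β) :=
    div_pos (mul_pos hδ (by linarith)) (by linarith)
  refine ⟨min ν (δ * (2 - β) / (2 * β)) / 2 / B, by positivity, fun k => ?_⟩
  have hD := H.linDen_pos k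
  have hDB : linDen f K x y k ≤ B :=
    (H.linDen_le k).trans ((le_abs_self _).trans (hB _ (H.x_mem (k + 1))))
  set c := min ν (δ * (2 - β) / (2 * β)) with hcdef
  have hc0 : 0 < c := lt_min hν hc
  have h1 := H.psi_succ_le k
  have h2 : c / 2 * stepLen x u k ^ 2 ≤ ν * ‖x k - x (k + 1)‖ ^ 2
      + δ * (2 - β) / (2 * β) * ‖u k - u (k + 1)‖ ^ 2 := by
    have h3 := mul_le_mul_of_nonneg_right (min_le_left ν (δ * (2 - β) / (2 * β)))
      (sq_nonneg ‖x k - x (k + 1)‖)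
    have h4 := mul_le_mul_of_nonneg_right (min_le_right ν (δ * (2 - β) / (2 * β)))
      (sq_nonneg ‖u k - u (k + 1)‖)
    rw [stepLen]
    nlinarith [mul_nonneg hc0.le (sq_nonneg (‖x k - x (k + 1)‖ - ‖u k - u (k + 1)‖))]
  have h5 : c / 2 / B * stepLen x u k ^ 2 * linDen f K x y k ≤ c / 2 * stepLen x u k ^ 2 := by
    have e : c / 2 / B * stepLen x u k ^ 2 * linDen f K x y k
        = c / 2 * stepLen x u k ^ 2 * (linDen f K x y k / B) := by ring
    rw [e]
    exact mul_le_of_le_one_right (by positivity) ((div_le_one hB0).2 hDB)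
  rw [linRatio]
  refine le_of_mul_le_mul_right ?_ hD
  rw [add_mul, div_mul_cancel₀ _ hD.ne']
  linarith

theorem linRatio_le (k : ℕ) : linRatio g h f A K δ γ x u y z k ≤ θ k := by
  obtain ⟨c, hc, h1⟩ := H.exists_linRatio_add_le
  have : 0 ≤ c * stepLen x u k ^ 2 := by positivity
  linarith [h1 k]

theorem antitone_θ : Antitone θ :=
  antitone_nat_of_succ_le fun k => (H.θ_succ_le_linRatio k).trans (H.linRatio_le k)

theorem exists_tendsto_θ : ∃ l, Tendsto θ atTop (𝓝 l) :=
  ⟨_, tendsto_atTop_ciInf H.antitone_θ ⟨0, by rintro _ ⟨k, rfl⟩; exact (H.θ_pos k).le⟩⟩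

theorem tendsto_linRatio {l : ℝ} (hl : Tendsto θ atTop (𝓝 l)) :
    Tendsto (linRatio g h f A K δ γ x u y z) atTop (𝓝 l) :=
  tendsto_of_tendsto_of_tendsto_of_le_of_le ((tendsto_add_atTop_iff_nat 1).2 hl) hl
    H.θ_succ_le_linRatio H.linRatio_le

theorem tendsto_stepLen : Tendsto (stepLen x u) atTop (𝓝 0) := by
  obtain ⟨l, hl⟩ := H.exists_tendsto_θ
  obtain ⟨c, hc, h1⟩ := H.exists_linRatio_add_le
  have h2 : Tendsto (fun k => (θ k - linRatio g h f A K δ γ x u y z k) / c) atTop (𝓝 0) := by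
    simpa using (hl.sub (H.tendsto_linRatio hl)).div_const c
  have h3 : Tendsto (fun k => stepLen x u k ^ 2) atTop (𝓝 0) := by
    refine squeeze_zero (fun k => sq_nonneg _) (fun k => ?_) h2
    rw [le_div_iff₀ hc]
    linarith [h1 k]
  have h4 := h3.sqrt
  simp only [Real.sqrt_zero] at h4
  refine h4.congr fun k => Real.sqrt_sq (stepLen_nonneg x u k)

end Iterates

end Iteration

namespace Iterates

variable {S O : Set E} {g : F → EReal} {h : E → ℝ} {h' : E → E} {Lh : ℝ} {f : G → EReal}
  {A : E →L[ℝ] F} {K : E →L[ℝ] G} {γ ν β δ m : ℝ} {x u : ℕ → E} {y : ℕ → G} {z : ℕ → F}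
  {θ : ℕ → ℝ} (H : Iterates S O g h h' Lh f A K γ ν β δ m x u y z θ)

theorem norm_x_sub_le (x u : ℕ → E) (k : ℕ) : ‖x (k + 1) - x k‖ ≤ stepLen x u k := by
  rw [stepLen, norm_sub_rev]
  linarith [norm_nonneg (u k - u (k + 1))]

theorem norm_u_sub_le (x u : ℕ → E) (k : ℕ) : ‖u k - u (k + 1)‖ ≤ stepLen x u k := by
  rw [stepLen]
  linarith [norm_nonneg (x k - x (k + 1))]

include H

theorem norm_z_sub_le (k : ℕ) : ‖z (k + 1) - z k‖ ≤ ‖A‖ / γ * ‖x (k + 1) - x k‖ := by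
  have h1 := mul_norm_sub_le_of_mem_subdiff H.g_proper (H.z_mem k) (H.z_mem (k + 1))
  rw [div_mul_eq_mul_div, le_div_iff₀ H.γ_pos]
  linarith

theorem exists_norm_le : ∃ R : ℝ, 0 ≤ R ∧
    ∀ k, ‖x k‖ ≤ R ∧ ‖u k‖ ≤ R ∧ ‖z k‖ ≤ R ∧ ‖y (k + 1)‖ ≤ R := by
  have hγ := H.γ_pos
  obtain ⟨R₁, hR₁⟩ := H.isCompact.isBounded.exists_norm_le
  obtain ⟨R₂, hR₂0, hR₂⟩ := exists_subgradient_bound H.f_proper.1 H.f_convex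
    (H.isCompact.image K.continuous) (by rintro _ ⟨a, ha, rfl⟩; exact H.K_mem a ha)
  obtain ⟨R₃, hR₃⟩ := H.tendsto_stepLen.bddAbove_range
  have h1 : ∀ k, ‖x k‖ ≤ R₁ := fun k => hR₁ _ (H.x_mem k)
  have hR₁0 : 0 ≤ R₁ := (norm_nonneg _).trans (h1 0)
  have h3 : ∀ k, ‖u (k + 1)‖ ≤ R₁ + β⁻¹ * R₃ := fun k => by
    have e : u (k + 1) = x (k + 1) - (x (k + 1) - u (k + 1)) := by abel
    rw [e]
    refine (norm_sub_le _ _).trans (add_le_add (h1 _) ((H.norm_x_sub_u_succ_le k).trans ?_))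
    exact mul_le_mul_of_nonneg_left (hR₃ ⟨k, rfl⟩) (inv_nonneg.2 H.β_mem.1.le)
  have h4 : ∀ k, ‖u k‖ ≤ max ‖u 0‖ (R₁ + β⁻¹ * R₃) := fun k => by
    cases k with
    | zero => exact le_max_left _ _
    | succ k => exact (h3 k).trans (le_max_right _ _)
  have h5 : ∀ k, ‖z k‖ ≤ ‖z 0‖ + ‖A‖ * (R₁ + R₁) / γ := fun k => by
    have h6 := mul_norm_sub_le_of_mem_subdiff H.g_proper (H.z_mem 0) (H.z_mem k)
    have h7 : ‖x k - x 0‖ ≤ R₁ + R₁ := (norm_sub_le _ _).trans (add_le_add (h1 _) (h1 _))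
    have h8 : ‖z k - z 0‖ ≤ ‖A‖ * (R₁ + R₁) / γ := by
      rw [le_div_iff₀ hγ]
      linarith [mul_le_mul_of_nonneg_left h7 (norm_nonneg A)]
    have e : z k = z 0 + (z k - z 0) := by abel
    calc ‖z k‖ = ‖z 0 + (z k - z 0)‖ := by rw [← e]
      _ ≤ _ := (norm_add_le _ _).trans (add_le_add le_rfl h8)
  have h6 : ∀ k, ‖y (k + 1)‖ ≤ R₂ := fun k => hR₂ _ ⟨_, H.x_mem k, rfl⟩ _ (H.y_mem k)
  set R₄ := max ‖u 0‖ (R₁ + β⁻¹ * R₃)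
  have hR₄0 : 0 ≤ R₄ := (norm_nonneg _).trans (h4 0)
  have hR₅0 : 0 ≤ ‖z 0‖ + ‖A‖ * (R₁ + R₁) / γ := (norm_nonneg _).trans (h5 0)
  refine ⟨R₁ + R₄ + (‖z 0‖ + ‖A‖ * (R₁ + R₁) / γ) + R₂, by positivity, fun k => ⟨?_, ?_, ?_, ?_⟩⟩
  · linarith [h1 k]
  · linarith [h4 k]
  · linarith [h5 k]
  · linarith [h6 k]

theorem exists_abs_f_sub_le : ∃ C : ℝ, 0 ≤ C ∧
    ∀ k, |(f (K (x (k + 1)))).toReal - (f (K (x k))).toReal| ≤ C * stepLen x u k ∧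
      |⟪K (x (k + 1) - x k), y (k + 1)⟫| ≤ C * stepLen x u k := by
  obtain ⟨R, hR0, hR⟩ := H.exists_norm_le
  have key : ∀ k i, |⟪K (x (k + 1) - x k), y (i + 1)⟫| ≤ ‖K‖ * R * stepLen x u k := fun k i => by
    calc |⟪K (x (k + 1) - x k), y (i + 1)⟫| ≤ ‖K (x (k + 1) - x k)‖ * ‖y (i + 1)‖ :=
          abs_real_inner_le_norm _ _
      _ ≤ (‖K‖ * ‖x (k + 1) - x k‖) * R :=
          mul_le_mul (K.le_opNorm _) (hR i).2.2.2 (norm_nonneg _) (by positivity)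
      _ ≤ (‖K‖ * stepLen x u k) * R := by
          gcongr
          exact norm_x_sub_le x u k
      _ = _ := by ring
  refine ⟨‖K‖ * R, by positivity, fun k => ⟨?_, key k k⟩⟩
  have h1 := H.linDen_le k
  have h2 := (mem_subdiff_iff (H.f_eq (H.x_mem (k + 1)))).1 (H.y_mem (k + 1)) _ _
    (H.f_eq (H.x_mem k)).le
  rw [real_inner_comm, ← map_sub, ← neg_sub (x (k + 1)), map_neg, inner_neg_left] at h2
  rw [linDen] at h1
  have h3 := abs_le.1 (key k k)
  have h4 := abs_le.1 (key k (k + 1))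
  exact abs_le.2 ⟨by linarith, by linarith⟩

theorem exists_abs_psi_sub_le : ∃ C : ℝ, 0 ≤ C ∧
    ∀ k, |psiR g h A δ γ (x k) (z k) (u k)
      - psiR g h A δ γ (x (k + 1)) (z (k + 1)) (u (k + 1))| ≤ C * stepLen x u k := by
  obtain ⟨R, hR0, hR⟩ := H.exists_norm_le
  have hδ := H.δ_pos
  have hγ := H.γ_pos
  have hLh := H.Lh_nonneg
  set s : ℕ → ℝ := stepLen x u with hs
  have hs0 : ∀ k, 0 ≤ s k := stepLen_nonneg x u
  have h1 : ∀ i k, |⟪z i, A (x (k + 1) - x k)⟫| ≤ R * ‖A‖ * s k := fun i k => by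
    calc |⟪z i, A (x (k + 1) - x k)⟫| ≤ ‖z i‖ * ‖A (x (k + 1) - x k)‖ :=
          abs_real_inner_le_norm _ _
      _ ≤ R * (‖A‖ * ‖x (k + 1) - x k‖) :=
          mul_le_mul (hR i).2.2.1 (A.le_opNorm _) (norm_nonneg _) hR0
      _ ≤ R * (‖A‖ * s k) := by
          gcongr
          exact norm_x_sub_le x u k
      _ = _ := by ring
  have h2 : ∀ k, ‖h' (x k)‖ ≤ ‖h' (x 0)‖ + Lh * (R + R) := fun k => by
    have h3 := H.h_lip _ (H.subset (H.x_mem k)) _ (H.subset (H.x_mem 0))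
    have h4 : ‖x k - x 0‖ ≤ R + R := (norm_sub_le _ _).trans (add_le_add (hR k).1 (hR 0).1)
    have h5 := mul_le_mul_of_nonneg_left h4 hLh
    have h6 := norm_sub_norm_le (h' (x k)) (h' (x 0))
    linarith
  set Q := ‖h' (x 0)‖ + Lh * (R + R) with hQ
  have hQ0 : 0 ≤ Q := (norm_nonneg _).trans (h2 0)
  have h3 : ∀ k, |h (x (k + 1)) - h (x k)| ≤ (Q + Lh * R) * s k := fun k => by
    have h4 : ‖x (k + 1) - x k‖ ≤ R + R :=
      (norm_sub_le _ _).trans (add_le_add (hR (k + 1)).1 (hR k).1)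
    have h5 : Lh / 2 * ‖x (k + 1) - x k‖ ^ 2 ≤ Lh * R * s k := by
      have h6 := mul_le_mul h4 (norm_x_sub_le x u k) (norm_nonneg _) (by positivity)
      have h7 := mul_le_mul_of_nonneg_left h6 hLh
      simp only [← hs] at h7
      nlinarith
    have h6 : ∀ i, |⟪h' (x i), x (k + 1) - x k⟫| ≤ Q * s k := fun i =>
      (abs_real_inner_le_norm _ _).trans
        (mul_le_mul (h2 i) (norm_x_sub_le x u k) (norm_nonneg _) hQ0)
    have h7 := le_add_inner_add_sq_of_lipschitz_gradient H.convex H.subset H.h_grad H.h_lip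
      (H.x_mem k) (H.x_mem (k + 1))
    have h8 := le_add_inner_add_sq_of_lipschitz_gradient H.convex H.subset H.h_grad H.h_lip
      (H.x_mem (k + 1)) (H.x_mem k)
    rw [← neg_sub, inner_neg_right, norm_neg] at h8
    have h9 := abs_le.1 (h6 k)
    have h10 := abs_le.1 (h6 (k + 1))
    exact abs_le.2 ⟨by linarith, by linarith⟩
  have h4 : ∀ k, |‖x (k + 1) - u (k + 1)‖ ^ 2 - ‖x k - u k‖ ^ 2| ≤ 4 * R * s k := fun k => by
    have h5 : |‖x (k + 1) - u (k + 1)‖ - ‖x k - u k‖| ≤ s k := by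
      refine (abs_norm_sub_norm_le _ _).trans ?_
      have e : x (k + 1) - u (k + 1) - (x k - u k) = -(x k - x (k + 1)) + (u k - u (k + 1)) := by
        abel
      rw [e]
      refine (norm_add_le _ _).trans ?_
      rw [norm_neg, hs, stepLen]
    have h6 : ∀ i, ‖x i - u i‖ ≤ R + R := fun i =>
      (norm_sub_le _ _).trans (add_le_add (hR i).1 (hR i).2.1)
    rw [sq_sub_sq, abs_mul, abs_of_nonneg (by positivity)]
    calc _ ≤ (R + R + (R + R)) * s k :=
          mul_le_mul (add_le_add (h6 _) (h6 _)) h5 (abs_nonneg _) (by positivity)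
      _ = _ := by ring
  refine ⟨R * ‖A‖ + (Q + Lh * R) + δ / 2 * (4 * R), by positivity, fun k => ?_⟩
  have h5 := coupling_sub_le H.g_proper (H.z_mem k) (H.z_mem (k + 1))
  have h6 := coupling_sub_le H.g_proper (H.z_mem (k + 1)) (H.z_mem k)
  have h7 : 0 ≤ γ / 2 * ‖z (k + 1) - z k‖ ^ 2 := by positivity
  have h8 := abs_le.1 (h1 k k)
  have h9 := abs_le.1 (h1 (k + 1) k)
  have h10 := abs_le.1 (h3 k)
  have h11 := abs_le.1 (h4 k)
  have h12 := mul_le_mul_of_nonneg_left h11.1 (half_pos hδ).le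
  have h13 := mul_le_mul_of_nonneg_left h11.2 (half_pos hδ).le
  rw [norm_sub_rev (z k)] at h6
  simp only [map_sub, inner_sub_left, inner_sub_right] at h5 h6 h8 h9
  refine abs_le.2 ⟨?_, ?_⟩ <;> simp only [psiR] <;> linarith

/-- The gradient in the primal variable at the new iterate is almost a normal direction. -/
theorem exists_abs_grad_le : ∃ C : ℝ, 0 ≤ C ∧ ∀ k d,
    |⟪ContinuousLinearMap.adjoint A (z (k + 1)) + h' (x (k + 1))
        + δ • (x (k + 1) - u (k + 1)), d⟫
      - ⟪ContinuousLinearMap.adjoint A (z k) - θ k • ContinuousLinearMap.adjoint K (y (k + 1))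
        + h' (x k) + δ • (x (k + 1) - u k), d⟫ - θ k * ⟪y (k + 1), K d⟫|
      ≤ C * stepLen x u k * ‖d‖ := by
  have hδ := H.δ_pos
  have hγ := H.γ_pos
  have hLh := H.Lh_nonneg
  refine ⟨‖A‖ * (‖A‖ / γ) + Lh + δ, by positivity, fun k d => ?_⟩
  have h1 : ‖ContinuousLinearMap.adjoint A (z (k + 1) - z k)‖
      ≤ ‖A‖ * (‖A‖ / γ) * stepLen x u k := by
    refine (ContinuousLinearMap.le_opNorm _ _).trans ?_
    rw [LinearIsometryEquiv.norm_map, mul_assoc]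
    refine mul_le_mul_of_nonneg_left ((H.norm_z_sub_le k).trans ?_) (norm_nonneg _)
    exact mul_le_mul_of_nonneg_left (norm_x_sub_le x u k) (by positivity)
  have h2 : ‖h' (x (k + 1)) - h' (x k)‖ ≤ Lh * stepLen x u k :=
    (H.h_lip _ (H.subset (H.x_mem _)) _ (H.subset (H.x_mem _))).trans
      (mul_le_mul_of_nonneg_left (norm_x_sub_le x u k) hLh)
  have h3 : ‖δ • (u k - u (k + 1))‖ ≤ δ * stepLen x u k := by
    rw [norm_smul, Real.norm_of_nonneg hδ.le]
    exact mul_le_mul_of_nonneg_left (norm_u_sub_le x u k) hδ.le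
  have e : ⟪ContinuousLinearMap.adjoint A (z (k + 1)) + h' (x (k + 1))
        + δ • (x (k + 1) - u (k + 1)), d⟫
      - ⟪ContinuousLinearMap.adjoint A (z k) - θ k • ContinuousLinearMap.adjoint K (y (k + 1))
        + h' (x k) + δ • (x (k + 1) - u k), d⟫ - θ k * ⟪y (k + 1), K d⟫
      = ⟪ContinuousLinearMap.adjoint A (z (k + 1) - z k) + (h' (x (k + 1)) - h' (x k))
        + δ • (u k - u (k + 1)), d⟫ := by
    simp only [map_sub, inner_add_left, inner_sub_left, inner_smul_left, conj_trivial,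
      ContinuousLinearMap.adjoint_inner_left]
    ring
  rw [e]
  refine (abs_real_inner_le_norm _ _).trans (mul_le_mul_of_nonneg_right ?_ (norm_nonneg _))
  refine (norm_add₃_le).trans ?_
  linarith

end Iterates

theorem gamFn_mkQuad (S : Set E) (g : F → EReal) (h : E → ℝ) (f : G → EReal)
    (A : E →L[ℝ] F) (K : E →L[ℝ] G) (δ γ m : ℝ) (a : E) {b : G} (c : F) (d : E) {t : ℝ}
    (ht : conj f b = t) (hm : m / 2 < ⟪K a, b⟫ - t) :
    gamFn S g h f A K δ γ m (mkQuad a b c d)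
      = psi S g h A δ γ a c d / ((⟪K a, b⟫ - t : ℝ) : EReal) := by
  have h1 : ((m / 2 : ℝ) : EReal) < ((⟪K a, b⟫ : ℝ) : EReal) - conj f b := by
    rw [ht, ← EReal.coe_sub, EReal.coe_lt_coe_iff]
    exact hm
  have h2 : gamFn S g h f A K δ γ m (mkQuad a b c d)
      = psi S g h A δ γ a c d / (((⟪K a, b⟫ : ℝ) : EReal) - conj f b) := if_pos h1
  rw [h2, ht, EReal.coe_sub]

theorem gamFn_eq_top_or {S : Set E} {g : F → EReal} (hg : ProperFn g) (h : E → ℝ) {f : G → EReal}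
    (hf : ProperFn f) (A : E →L[ℝ] F) (K : E →L[ℝ] G) (δ γ : ℝ) {m : ℝ} (hm : 0 < m) (a : E)
    (b : G) {c : F} (d : E) (hc : conj g c ≠ ⊤) :
    gamFn S g h f A K δ γ m (mkQuad a b c d) = ⊤ ∨ (a ∈ S ∧ ∃ t : ℝ, conj f b = t ∧
      m / 2 < ⟪K a, b⟫ - t ∧ gamFn S g h f A K δ γ m (mkQuad a b c d)
        = ((psiR g h A δ γ a c d / (⟪K a, b⟫ - t) : ℝ) : EReal)) := by
  by_cases h1 : ((m / 2 : ℝ) : EReal) < ((⟪K a, b⟫ : ℝ) : EReal) - conj f b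
  · have hb : conj f b ≠ ⊤ := by
      intro hb
      rw [hb, EReal.sub_top] at h1
      exact not_lt_bot h1
    obtain ⟨t, ht⟩ := exists_real_of_ne_top (conj_ne_bot hf) hb
    rw [ht, ← EReal.coe_sub, EReal.coe_lt_coe_iff] at h1
    rw [gamFn_mkQuad S g h f A K δ γ m a c d ht h1]
    by_cases ha : a ∈ S
    · refine Or.inr ⟨ha, t, ht, h1, ?_⟩
      rw [psi_eq_psiR hg h A δ γ d ha hc, ← EReal.coe_div]
    · left
      rw [psi_eq_top hg h A δ γ d ha hc]
      refine EReal.top_div_of_pos_ne_top ?_ (EReal.coe_ne_top _)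
      exact EReal.coe_pos.2 (by linarith)
  · exact Or.inl (if_neg h1)

theorem piFn_eq_top_or {S : Set E} {g : F → EReal} (hg : ProperFn g) (h : E → ℝ) {f : G → EReal}
    (A : E →L[ℝ] F) (K : E →L[ℝ] G) (δ γ : ℝ) {a : E} {c : F} (d : E) (hc : conj g c ≠ ⊤) {r : ℝ}
    (hr : f (K a) = r) (hr0 : 0 < r) :
    piFn S g h f A K δ γ (mkTrip a c d) = ⊤ ∨ (a ∈ S ∧ piFn S g h f A K δ γ (mkTrip a c d)
        = ((psiR g h A δ γ a c d / r : ℝ) : EReal)) := by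
  have h2 : piFn S g h f A K δ γ (mkTrip a c d) = psi S g h A δ γ a c d / f (K a) := rfl
  rw [h2, hr]
  by_cases ha : a ∈ S
  · refine Or.inr ⟨ha, ?_⟩
    rw [psi_eq_psiR hg h A δ γ d ha hc, ← EReal.coe_div]
  · left
    rw [psi_eq_top hg h A δ γ d ha hc]
    exact EReal.top_div_of_pos_ne_top (EReal.coe_pos.2 hr0) (EReal.coe_ne_top _)

namespace Iterates

variable {S O : Set E} {g : F → EReal} {h : E → ℝ} {h' : E → E} {Lh : ℝ} {f : G → EReal}
  {A : E →L[ℝ] F} {K : E →L[ℝ] G} {γ ν β δ m : ℝ} {x u : ℕ → E} {y : ℕ → G} {z : ℕ → F}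
  {θ : ℕ → ℝ} (H : Iterates S O g h h' Lh f A K γ ν β δ m x u y z θ)

include H

theorem conj_f_eq (k : ℕ) : conj f (y (k + 1))
    = ((⟪y (k + 1), K (x k)⟫ - (f (K (x k))).toReal : ℝ) : EReal) :=
  conj_eq_of_mem_subdiff H.f_proper.1 (H.f_eq (H.x_mem k)) (H.y_mem k)

theorem linDen_eq (k : ℕ) : ⟪K (x (k + 1)), y (k + 1)⟫
    - (⟪y (k + 1), K (x k)⟫ - (f (K (x k))).toReal) = linDen f K x y k := by
  rw [linDen, map_sub, inner_sub_left, real_inner_comm (K (x k))]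
  ring

theorem eventually_lt_linDen : ∀ᶠ k in atTop, m / 2 < linDen f K x y k := by
  obtain ⟨C, hC0, hC⟩ := H.exists_abs_f_sub_le
  have h1 : Tendsto (fun k => m - C * stepLen x u k) atTop (𝓝 (m - C * 0)) :=
    tendsto_const_nhds.sub (H.tendsto_stepLen.const_mul C)
  have h2 : m / 2 < m - C * 0 := by linarith [H.m_pos]
  filter_upwards [h1.eventually (lt_mem_nhds h2)] with k hk
  have h3 := abs_le.1 (hC k).2
  have h4 := H.le_f _ (H.x_mem k)
  rw [linDen]
  linarith

theorem gamFn_iterate {k : ℕ} (hk : m / 2 < linDen f K x y k) :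
    gamFn S g h f A K δ γ m (mkQuad (x (k + 1)) (y (k + 1)) (z (k + 1)) (u (k + 1)))
      = ((linRatio g h f A K δ γ x u y z k : ℝ) : EReal) := by
  rw [← H.linDen_eq] at hk
  rw [gamFn_mkQuad S g h f A K δ γ m _ _ _ (H.conj_f_eq k) hk, H.linDen_eq,
    psi_eq_psiR H.g_proper h A δ γ _ (H.x_mem _)
      (conj_ne_top_of_mem_subdiff H.g_proper.1 (H.z_mem _)), ← EReal.coe_div]
  rfl

theorem exists_frechetSubdiff_gamFn : ∃ C : ℝ, 0 < C ∧ ∀ᶠ k in atTop,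
    ∃ v ∈ frechetSubdiff (gamFn S g h f A K δ γ m)
      (mkQuad (x (k + 1)) (y (k + 1)) (z (k + 1)) (u (k + 1))), ‖v‖ ≤ C * stepLen x u k := by
  obtain ⟨C₁, hC₁0, hC₁⟩ := H.exists_abs_grad_le
  obtain ⟨C₂, hC₂0, hC₂⟩ := H.exists_abs_f_sub_le
  obtain ⟨C₃, hC₃0, hC₃⟩ := H.exists_abs_psi_sub_le
  obtain ⟨R, hR0, hR⟩ := H.exists_norm_le
  have hδ := H.δ_pos
  have hm := H.m_pos
  have hβ := H.β_mem.1
  have hθ0 := H.θ_pos 0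
  refine ⟨(C₁ + (C₃ + θ 0 * C₂) / (m / 2) * (R * ‖K‖) + δ * β⁻¹ + θ 0 * ‖K‖) / (m / 2) + 1,
    by positivity, ?_⟩
  filter_upwards [H.eventually_lt_linDen] with k hk
  have hs := stepLen_nonneg x u k
  set s := stepLen x u k with hsdef
  set px : WithLp 2 (E × WithLp 2 (G × WithLp 2 (F × E))) →L[ℝ] E := WithLp.fstL 2 ℝ _ _
  set p₁ : WithLp 2 (E × WithLp 2 (G × WithLp 2 (F × E))) →L[ℝ] _ := WithLp.sndL 2 ℝ _ _
  set py : WithLp 2 (E × WithLp 2 (G × WithLp 2 (F × E))) →L[ℝ] G :=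
    (WithLp.fstL 2 ℝ _ _).comp p₁
  set p₂ : WithLp 2 (E × WithLp 2 (G × WithLp 2 (F × E))) →L[ℝ] _ :=
    (WithLp.sndL 2 ℝ _ _).comp p₁
  set pz : WithLp 2 (E × WithLp 2 (G × WithLp 2 (F × E))) →L[ℝ] F :=
    (WithLp.fstL 2 ℝ _ _).comp p₂
  set pu : WithLp 2 (E × WithLp 2 (G × WithLp 2 (F × E))) →L[ℝ] E :=
    (WithLp.sndL 2 ℝ _ _).comp p₂
  have hp : ∀ p, p = mkQuad (px p) (py p) (pz p) (pu p) := fun p => rfl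
  have hpx : ∀ p, ‖px p‖ ≤ ‖p‖ := fun p => WithLp.norm_fst_le _ p
  have hp₁ : ∀ p, ‖p₁ p‖ ≤ ‖p‖ := fun p => WithLp.norm_snd_le _ p
  have hp₂ : ∀ p, ‖p₂ p‖ ≤ ‖p‖ := fun p => (WithLp.norm_snd_le _ (p₁ p)).trans (hp₁ p)
  have hpy : ∀ p, ‖py p‖ ≤ ‖p‖ := fun p => (WithLp.norm_fst_le _ (p₁ p)).trans (hp₁ p)
  have hpu : ∀ p, ‖pu p‖ ≤ ‖p‖ := fun p => (WithLp.norm_snd_le _ (p₂ p)).trans (hp₂ p)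
  set q := mkQuad (x (k + 1)) (y (k + 1)) (z (k + 1)) (u (k + 1)) with hq
  have hqx : px q = x (k + 1) := rfl
  have hqy : py q = y (k + 1) := rfl
  have hqz : pz q = z (k + 1) := rfl
  have hqu : pu q = u (k + 1) := rfl
  set n := ContinuousLinearMap.adjoint A (z k) - θ k • ContinuousLinearMap.adjoint K (y (k + 1))
    + h' (x k) + δ • (x (k + 1) - u k) with hn
  have hN := hasFDerivAt_psiR H.g_proper H.g_convex H.g_lsc H.g_ess (A := A) δ (γ := γ)
    (px := px) (pu := pu) (pz := pz) (q := q) (H.h_grad _ (H.subset (H.x_mem (k + 1))))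
    (H.z_mem (k + 1))
  have hD : HasFDerivAt (fun p => (f (K (x k))).toReal + ⟪K (px p) - K (x k), py p⟫) _ q :=
    ((((K.comp px).hasFDerivAt (x := q)).sub_const (K (x k))).inner ℝ
      (py.hasFDerivAt (x := q))).const_add (f (K (x k))).toReal
  have hDq : (f (K (x k))).toReal + ⟪K (px q) - K (x k), py q⟫ = linDen f K x y k := by
    rw [linDen, map_sub, hqx, hqy]
  have hM : psiR g h A δ γ (px q) (pz q) (pu q)
      / ((f (K (x k))).toReal + ⟪K (px q) - K (x k), py q⟫)
      = linRatio g h f A K δ γ x u y z k := by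
    rw [hDq]; rfl
  have hM0 : 0 < linRatio g h f A K δ γ x u y z k := (H.θ_pos _).trans_le (H.θ_succ_le_linRatio k)
  suffices hv : ∃ v ∈ frechetSubdiff (gamFn S g h f A K δ γ m) q,
      ‖v‖ ≤ ((C₁ + (C₃ + θ 0 * C₂) / (m / 2) * (R * ‖K‖) + δ * β⁻¹ + θ 0 * ‖K‖) / (m / 2)) * s by
    obtain ⟨v, hv, hvB⟩ := hv
    exact ⟨v, hv, hvB.trans (mul_le_mul_of_nonneg_right (by linarith) hs)⟩
  refine exists_frechetSubdiff_of_ratio (ν := -(innerSL ℝ n).comp px) (by positivity) hN hD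
    (hDq ▸ H.linDen_pos k) (by rw [hM]; exact H.gamFn_iterate hk) ?_ ?_
  · have h1 : ∀ᶠ p in 𝓝 q, conj g (pz p) ≠ ⊤ :=
      (pz.continuous.tendsto q).eventually (eventually_conj_ne_top H.g_proper.1 H.g_convex H.g_lsc
        H.g_ess (H.z_mem (k + 1)))
    have h2 : ∀ᶠ p in 𝓝 q, 0 < psiR g h A δ γ (px p) (pz p) (pu p) :=
      hN.continuousAt.eventually (lt_mem_nhds (H.psi_pos (k + 1)))
    filter_upwards [h1, h2] with p h1 h2
    rcases gamFn_eq_top_or (S := S) H.g_proper h H.f_proper A K δ γ hm (px p) (py p) (pu p) h1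
      with h3 | ⟨hS, t, ht, htm, h3⟩
    · exact Or.inl h3
    refine Or.inr ⟨?_, ?_⟩
    · rw [hp p, h3, EReal.coe_le_coe_iff]
      refine div_le_div_of_nonneg_left h2.le (by linarith) ?_
      have h4 := le_conj (H.f_eq (H.x_mem k)) (py p)
      rw [ht, EReal.coe_le_coe_iff] at h4
      change ⟪K (px p), py p⟫ - t ≤ (f (K (x k))).toReal + ⟪K (px p) - K (x k), py p⟫
      rw [inner_sub_left, real_inner_comm (py p) (K (x k))]
      linarith
    · have h4 := H.inner_nonneg k _ hS
      simp only [_root_.neg_apply, ContinuousLinearMap.comp_apply,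
        innerSL_apply_apply, map_sub, hqx]
      rw [← hn, inner_sub_right] at h4
      linarith
  · intro d
    rw [hM, hDq]
    set M := linRatio g h f A K δ γ x u y z k with hMdef
    have hθM : |θ k - M| ≤ (C₃ + θ 0 * C₂) / (m / 2) * s := by
      have h1 : (θ k - M) * linDen f K x y k
          = psiR g h A δ γ (x k) (z k) (u k) - psiR g h A δ γ (x (k + 1)) (z (k + 1)) (u (k + 1))
            + θ k * ⟪K (x (k + 1) - x k), y (k + 1)⟫ := by
        rw [sub_mul, hMdef, linRatio, div_mul_cancel₀ _ (H.linDen_pos k).ne', linDen, mul_add,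
          H.θ_mul]
        ring
      have h2 : |θ k - M| * (m / 2) ≤ (C₃ + θ 0 * C₂) * s := by
        calc |θ k - M| * (m / 2) ≤ |θ k - M| * linDen f K x y k :=
              mul_le_mul_of_nonneg_left hk.le (abs_nonneg _)
          _ = |(θ k - M) * linDen f K x y k| := by rw [abs_mul, abs_of_pos (H.linDen_pos k)]
          _ ≤ C₃ * s + θ 0 * (C₂ * s) := by
              rw [h1]
              refine (abs_add_le _ _).trans (add_le_add (hC₃ k) ?_)
              rw [abs_mul, abs_of_pos (H.θ_pos k)]
              exact mul_le_mul (H.antitone_θ (Nat.zero_le k)) (hC₂ k).2 (abs_nonneg _) hθ0.le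
          _ = _ := by ring
      rw [div_mul_eq_mul_div, le_div_iff₀ (half_pos hm)]
      exact h2
    have hMθ : M ≤ θ 0 := (H.linRatio_le k).trans (H.antitone_θ (Nat.zero_le k))
    have h1 := hC₁ k (px d)
    have h2 : |(θ k - M) * ⟪y (k + 1), K (px d)⟫|
        ≤ (C₃ + θ 0 * C₂) / (m / 2) * s * (R * (‖K‖ * ‖d‖)) := by
      rw [abs_mul]
      refine mul_le_mul hθM ?_ (abs_nonneg _) (by positivity)
      refine (abs_real_inner_le_norm _ _).trans (mul_le_mul (hR k).2.2.2 ?_ (norm_nonneg _) hR0)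
      exact (K.le_opNorm _).trans (mul_le_mul_of_nonneg_left (hpx d) (norm_nonneg _))
    have h3 : |δ * ⟪x (k + 1) - u (k + 1), pu d⟫| ≤ δ * (β⁻¹ * s * ‖d‖) := by
      rw [abs_mul, abs_of_pos hδ]
      refine mul_le_mul_of_nonneg_left ?_ hδ.le
      exact (abs_real_inner_le_norm _ _).trans (mul_le_mul (H.norm_x_sub_u_succ_le k) (hpu d)
        (norm_nonneg _) (by positivity))
    have h4 : |M * ⟪K (x (k + 1) - x k), py d⟫| ≤ θ 0 * (‖K‖ * s * ‖d‖) := by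
      rw [abs_mul, abs_of_pos hM0]
      refine mul_le_mul hMθ ?_ (abs_nonneg _) hθ0.le
      refine (abs_real_inner_le_norm _ _).trans (mul_le_mul ?_ (hpy d) (norm_nonneg _)
        (by positivity))
      exact (K.le_opNorm _).trans (mul_le_mul_of_nonneg_left (norm_x_sub_le x u k) (norm_nonneg _))
    have h5 : C₁ * s * ‖px d‖ ≤ C₁ * s * ‖d‖ :=
      mul_le_mul_of_nonneg_left (hpx d) (by positivity)
    set T := C₁ + (C₃ + θ 0 * C₂) / (m / 2) * (R * ‖K‖) + δ * β⁻¹ + θ 0 * ‖K‖ with hT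
    have h6 : T * s * ‖d‖ ≤ T / (m / 2) * s * linDen f K x y k * ‖d‖ := by
      have hT0 : 0 ≤ T := by positivity
      have e : T * s * ‖d‖ = T / (m / 2) * s * (m / 2) * ‖d‖ := by field_simp
      rw [e]
      gcongr
    refine le_trans ?_ h6
    simp only [_root_.sub_apply, _root_.neg_apply, ContinuousLinearMap.comp_apply,
      innerSL_apply_apply, fderivInnerCLM_apply, ContinuousLinearMap.prod_apply, hqx, hqy, hqz,
      hqu, ← map_sub] at h1 ⊢
    rw [real_inner_comm (y (k + 1)) (K (px d)), real_inner_smul_left]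
    rw [← hn] at h1
    have h7 : T * s * ‖d‖ = C₁ * s * ‖d‖
        + (C₃ + θ 0 * C₂) / (m / 2) * s * (R * (‖K‖ * ‖d‖)) + δ * (β⁻¹ * s * ‖d‖)
        + θ 0 * (‖K‖ * s * ‖d‖) := by
      rw [hT]; ring
    rw [h7]
    replace h1 := abs_le.1 (h1.trans h5)
    replace h2 := abs_le.1 h2
    replace h3 := abs_le.1 h3
    replace h4 := abs_le.1 h4
    rw [sub_mul] at h2
    rw [mul_add]
    exact abs_le.2 ⟨by linarith only [h1.1, h2.1, h3.2, h4.2],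
      by linarith only [h1.2, h2.2, h3.1, h4.1]⟩

end Iterates

theorem eq_gradient_of_mem_subdiff {f : G → EReal} (hb : ∀ x, f x ≠ ⊥) {w v w' : G}
    (hv : v ∈ subdiff f w) (hdom : ∀ᶠ p in 𝓝 w, f p ≠ ⊤)
    (hgrad : HasGradientAt (fun p => (f p).toReal) w' w) : v = w' := by
  have h1 : IsLocalMin (fun p => (f p).toReal - ⟪v, p⟫) w := by
    filter_upwards [hdom] with p hp
    have h2 := (mem_subdiff_iff (EReal.coe_toReal hv.1 (hb w)).symm).1 hv p _
      (EReal.coe_toReal hp (hb p)).ge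
    rw [inner_sub_right] at h2
    linarith
  have h2 := (hasGradientAt_iff_hasFDerivAt.1 hgrad).sub ((innerSL ℝ v).hasFDerivAt (x := w))
  have h3 := h1.hasFDerivAt_eq_zero h2
  refine (ext_inner_right ℝ fun d => ?_).symm
  have h4 := DFunLike.congr_fun h3 d
  simp only [_root_.sub_apply, InnerProductSpace.toDual_apply_apply, innerSL_apply_apply,
    _root_.zero_apply] at h4
  linarith

theorem norm_le_norm_fst_add_norm_snd {X Y : Type*} [NormedAddCommGroup X] [NormedAddCommGroup Y]
    (q : WithLp 2 (X × Y)) : ‖q‖ ≤ ‖q.fst‖ + ‖q.snd‖ := by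
  rw [WithLp.prod_norm_eq_of_L2]
  refine Real.sqrt_le_iff.2 ⟨by positivity, ?_⟩
  rw [add_sq]
  linarith [mul_nonneg (norm_nonneg q.fst) (norm_nonneg q.snd)]

theorem norm_mkTrip_le (a : E) (c : F) (d : E) : ‖mkTrip a c d‖ ≤ ‖a‖ + (‖c‖ + ‖d‖) :=
  (norm_le_norm_fst_add_norm_snd (mkTrip a c d)).trans
    (add_le_add le_rfl (norm_le_norm_fst_add_norm_snd (mkTrip a c d).snd))

theorem norm_mkQuad_le (a : E) (b : G) (c : F) (d : E) :
    ‖mkQuad a b c d‖ ≤ ‖a‖ + (‖b‖ + (‖c‖ + ‖d‖)) :=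
  (norm_le_norm_fst_add_norm_snd (mkQuad a b c d)).trans
    (add_le_add le_rfl ((norm_le_norm_fst_add_norm_snd (mkQuad a b c d).snd).trans
      (add_le_add le_rfl (norm_le_norm_fst_add_norm_snd (mkQuad a b c d).snd.snd))))

namespace Iterates

variable {S O : Set E} {g : F → EReal} {h : E → ℝ} {h' : E → E} {Lh : ℝ} {f : G → EReal}
  {A : E →L[ℝ] F} {K : E →L[ℝ] G} {γ ν β δ m : ℝ} {x u : ℕ → E} {y : ℕ → G} {z : ℕ → F}
  {θ : ℕ → ℝ} (H : Iterates S O g h h' Lh f A K γ ν β δ m x u y z θ)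

include H

theorem exists_frechetSubdiff_piFn {O' : Set G} {f' : G → G} {Lf : ℝ} (hO' : IsOpen O')
    (hKO : K '' S ⊆ O') (hdom : ∀ w ∈ O', f w ≠ ⊤)
    (hgrad : ∀ w ∈ O', HasGradientAt (fun v => (f v).toReal) (f' w) w)
    (hlip : ∀ w ∈ O', ∀ v ∈ O', ‖f' w - f' v‖ ≤ Lf * ‖w - v‖) : ∃ C : ℝ, 0 < C ∧ ∀ k,
    ∃ v ∈ frechetSubdiff (piFn S g h f A K δ γ) (mkTrip (x (k + 1)) (z (k + 1)) (u (k + 1))),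
      ‖v‖ ≤ C * stepLen x u k := by
  obtain ⟨C₁, hC₁0, hC₁⟩ := H.exists_abs_grad_le
  obtain ⟨C₂, hC₂0, hC₂⟩ := H.exists_abs_f_sub_le
  obtain ⟨C₃, hC₃0, hC₃⟩ := H.exists_abs_psi_sub_le
  obtain ⟨R, hR0, hR⟩ := H.exists_norm_le
  have hδ := H.δ_pos
  have hm := H.m_pos
  have hβ := H.β_mem.1
  have hθ0 := H.θ_pos 0
  have hKx : ∀ k, K (x k) ∈ O' := fun k => hKO ⟨_, H.x_mem k, rfl⟩
  refine ⟨(C₁ + (C₃ + θ 0 * C₂) / m * (R * ‖K‖) + δ * β⁻¹ + θ 0 * (|Lf| * ‖K‖ * ‖K‖)) / m + 1,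
    by positivity, fun k => ?_⟩
  have hs := stepLen_nonneg x u k
  set s := stepLen x u k with hsdef
  have hyf : y (k + 1) = f' (K (x k)) := eq_gradient_of_mem_subdiff H.f_proper.1 (H.y_mem k)
    (Filter.mem_of_superset (hO'.mem_nhds (hKx k)) hdom) (hgrad _ (hKx k))
  set px : WithLp 2 (E × WithLp 2 (F × E)) →L[ℝ] E := WithLp.fstL 2 ℝ _ _
  set p₂ : WithLp 2 (E × WithLp 2 (F × E)) →L[ℝ] _ := WithLp.sndL 2 ℝ _ _
  set pz : WithLp 2 (E × WithLp 2 (F × E)) →L[ℝ] F := (WithLp.fstL 2 ℝ _ _).comp p₂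
  set pu : WithLp 2 (E × WithLp 2 (F × E)) →L[ℝ] E := (WithLp.sndL 2 ℝ _ _).comp p₂
  have hp : ∀ p, p = mkTrip (px p) (pz p) (pu p) := fun p => rfl
  have hpx : ∀ p, ‖px p‖ ≤ ‖p‖ := fun p => WithLp.norm_fst_le _ p
  have hp₂ : ∀ p, ‖p₂ p‖ ≤ ‖p‖ := fun p => WithLp.norm_snd_le _ p
  have hpu : ∀ p, ‖pu p‖ ≤ ‖p‖ := fun p => (WithLp.norm_snd_le _ (p₂ p)).trans (hp₂ p)
  set q := mkTrip (x (k + 1)) (z (k + 1)) (u (k + 1)) with hq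
  have hqx : px q = x (k + 1) := rfl
  have hqz : pz q = z (k + 1) := rfl
  have hqu : pu q = u (k + 1) := rfl
  set n := ContinuousLinearMap.adjoint A (z k) - θ k • ContinuousLinearMap.adjoint K (y (k + 1))
    + h' (x k) + δ • (x (k + 1) - u k) with hn
  have hN := hasFDerivAt_psiR H.g_proper H.g_convex H.g_lsc H.g_ess (A := A) δ (γ := γ)
    (px := px) (pu := pu) (pz := pz) (q := q) (H.h_grad _ (H.subset (H.x_mem (k + 1))))
    (H.z_mem (k + 1))
  have hD : HasFDerivAt (fun p => (f (K (px p))).toReal)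
      ((InnerProductSpace.toDual ℝ G (f' (K (x (k + 1))))).comp (K.comp px)) q :=
    HasFDerivAt.comp (g := fun v => (f v).toReal) q
      (hasGradientAt_iff_hasFDerivAt.1 (hgrad _ (hKx (k + 1)))) (K.comp px).hasFDerivAt
  have hDm : m ≤ (f (K (px q))).toReal := H.le_f _ (H.x_mem _)
  have hDq : 0 < (f (K (px q))).toReal := hm.trans_le hDm
  have hM : psiR g h A δ γ (px q) (pz q) (pu q) / (f (K (px q))).toReal = θ (k + 1) := by
    rw [div_eq_iff hDq.ne', hqx, H.θ_mul]
    rfl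
  suffices hv : ∃ v ∈ frechetSubdiff (piFn S g h f A K δ γ) q,
      ‖v‖ ≤ ((C₁ + (C₃ + θ 0 * C₂) / m * (R * ‖K‖) + δ * β⁻¹ + θ 0 * (|Lf| * ‖K‖ * ‖K‖)) / m)
        * s by
    obtain ⟨v, hv, hvB⟩ := hv
    exact ⟨v, hv, hvB.trans (mul_le_mul_of_nonneg_right (by linarith) hs)⟩
  refine exists_frechetSubdiff_of_ratio (ν := -(innerSL ℝ n).comp px) (by positivity) hN hD
    hDq ?_ ?_ ?_
  · rcases piFn_eq_top_or (S := S) H.g_proper h A K δ γ (pu q)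
      (conj_ne_top_of_mem_subdiff H.g_proper.1 (H.z_mem (k + 1))) (H.f_eq (H.x_mem (k + 1))) hDq
      with h1 | h1
    · exfalso
      have h2 : piFn S g h f A K δ γ (mkTrip (x (k + 1)) (z (k + 1)) (pu q))
          = psi S g h A δ γ (x (k + 1)) (z (k + 1)) (pu q) / f (K (x (k + 1))) := rfl
      rw [h2, psi_eq_psiR H.g_proper h A δ γ _ (H.x_mem _)
        (conj_ne_top_of_mem_subdiff H.g_proper.1 (H.z_mem _)), H.f_eq (H.x_mem _),
        ← EReal.coe_div] at h1
      exact EReal.coe_ne_top _ h1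
    · exact h1.2
  · have h1 : ∀ᶠ p in 𝓝 q, conj g (pz p) ≠ ⊤ :=
      (pz.continuous.tendsto q).eventually (eventually_conj_ne_top H.g_proper.1 H.g_convex H.g_lsc
        H.g_ess (H.z_mem (k + 1)))
    have h2 : ∀ᶠ p in 𝓝 q, 0 < (f (K (px p))).toReal :=
      hD.continuousAt.eventually (lt_mem_nhds hDq)
    have h3 : ∀ᶠ p in 𝓝 q, K (px p) ∈ O' :=
      ((K.comp px).continuous.tendsto q).eventually (hO'.mem_nhds (hKx (k + 1)))
    filter_upwards [h1, h2, h3] with p h1 h2 h3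
    rcases piFn_eq_top_or (S := S) H.g_proper h A K δ γ (pu p) h1
      (EReal.coe_toReal (hdom _ h3) (H.f_proper.1 _)).symm h2 with h4 | ⟨hS, h4⟩
    · exact Or.inl h4
    · refine Or.inr ⟨h4.ge, ?_⟩
      have h4 := H.inner_nonneg k _ hS
      simp only [_root_.neg_apply, ContinuousLinearMap.comp_apply, innerSL_apply_apply, map_sub,
        hqx]
      rw [← hn, inner_sub_right] at h4
      linarith
  · intro d
    rw [hM]
    have hθθ : |θ k - θ (k + 1)| ≤ (C₃ + θ 0 * C₂) / m * s := by
      have h1 : (θ k - θ (k + 1)) * (f (K (x (k + 1)))).toReal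
          = psiR g h A δ γ (x k) (z k) (u k) - psiR g h A δ γ (x (k + 1)) (z (k + 1)) (u (k + 1))
            + θ k * ((f (K (x (k + 1)))).toReal - (f (K (x k))).toReal) := by
        rw [← H.θ_mul, ← H.θ_mul]
        ring
      have h2 : |θ k - θ (k + 1)| * m ≤ (C₃ + θ 0 * C₂) * s := by
        calc |θ k - θ (k + 1)| * m ≤ |θ k - θ (k + 1)| * (f (K (x (k + 1)))).toReal :=
              mul_le_mul_of_nonneg_left hDm (abs_nonneg _)
          _ = |(θ k - θ (k + 1)) * (f (K (x (k + 1)))).toReal| := by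
              rw [abs_mul, abs_of_pos (a := (f (K (x (k + 1)))).toReal) hDq]
          _ ≤ C₃ * s + θ 0 * (C₂ * s) := by
              rw [h1]
              refine (abs_add_le _ _).trans (add_le_add (hC₃ k) ?_)
              rw [abs_mul, abs_of_pos (H.θ_pos k)]
              exact mul_le_mul (H.antitone_θ (Nat.zero_le k)) (hC₂ k).1 (abs_nonneg _) hθ0.le
          _ = _ := by ring
      rw [div_mul_eq_mul_div, le_div_iff₀ hm]
      exact h2
    have h1 := hC₁ k (px d)
    have hKd : ‖K (px d)‖ ≤ ‖K‖ * ‖d‖ :=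
      (K.le_opNorm _).trans (mul_le_mul_of_nonneg_left (hpx d) (norm_nonneg _))
    have h2 : |(θ k - θ (k + 1)) * ⟪y (k + 1), K (px d)⟫|
        ≤ (C₃ + θ 0 * C₂) / m * s * (R * (‖K‖ * ‖d‖)) := by
      rw [abs_mul]
      refine mul_le_mul hθθ ?_ (abs_nonneg _) (by positivity)
      exact (abs_real_inner_le_norm _ _).trans (mul_le_mul (hR k).2.2.2 hKd (norm_nonneg _) hR0)
    have h3 : |δ * ⟪x (k + 1) - u (k + 1), pu d⟫| ≤ δ * (β⁻¹ * s * ‖d‖) := by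
      rw [abs_mul, abs_of_pos hδ]
      refine mul_le_mul_of_nonneg_left ?_ hδ.le
      exact (abs_real_inner_le_norm _ _).trans (mul_le_mul (H.norm_x_sub_u_succ_le k) (hpu d)
        (norm_nonneg _) (by positivity))
    have h4 : |θ (k + 1) * ⟪y (k + 1) - f' (K (x (k + 1))), K (px d)⟫|
        ≤ θ 0 * ((|Lf| * (‖K‖ * s)) * (‖K‖ * ‖d‖)) := by
      rw [abs_mul, abs_of_pos (H.θ_pos _)]
      refine mul_le_mul (H.antitone_θ (Nat.zero_le _)) ?_ (abs_nonneg _) hθ0.le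
      refine (abs_real_inner_le_norm _ _).trans (mul_le_mul ?_ hKd (norm_nonneg _)
        (by positivity))
      rw [hyf, norm_sub_rev]
      refine (hlip _ (hKx _) _ (hKx _)).trans
        (mul_le_mul (le_abs_self _) ?_ (norm_nonneg _) (abs_nonneg _))
      rw [← map_sub]
      exact (K.le_opNorm _).trans (mul_le_mul_of_nonneg_left (norm_x_sub_le x u k) (norm_nonneg _))
    have h5 : C₁ * s * ‖px d‖ ≤ C₁ * s * ‖d‖ :=
      mul_le_mul_of_nonneg_left (hpx d) (by positivity)
    set T := C₁ + (C₃ + θ 0 * C₂) / m * (R * ‖K‖) + δ * β⁻¹ + θ 0 * (|Lf| * ‖K‖ * ‖K‖) with hT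
    have h6 : T * s * ‖d‖ ≤ T / m * s * (f (K (px q))).toReal * ‖d‖ := by
      have hT0 : 0 ≤ T := by positivity
      have e : T * s * ‖d‖ = T / m * s * m * ‖d‖ := by field_simp
      rw [e]
      gcongr
    refine le_trans ?_ h6
    simp only [_root_.sub_apply, _root_.neg_apply, ContinuousLinearMap.comp_apply,
      innerSL_apply_apply, InnerProductSpace.toDual_apply_apply, hqx, hqz, hqu] at h1 ⊢
    rw [real_inner_smul_left]
    rw [← hn] at h1
    have h7 : T * s * ‖d‖ = C₁ * s * ‖d‖
        + (C₃ + θ 0 * C₂) / m * s * (R * (‖K‖ * ‖d‖)) + δ * (β⁻¹ * s * ‖d‖)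
        + θ 0 * ((|Lf| * (‖K‖ * s)) * (‖K‖ * ‖d‖)) := by
      rw [hT]; ring
    rw [h7]
    replace h1 := abs_le.1 (h1.trans h5)
    replace h2 := abs_le.1 h2
    replace h3 := abs_le.1 h3
    replace h4 := abs_le.1 h4
    rw [sub_mul] at h2
    rw [inner_sub_left, mul_sub] at h4
    exact abs_le.2 ⟨by linarith only [h1.1, h2.1, h3.2, h4.1],
      by linarith only [h1.2, h2.2, h3.1, h4.2]⟩

end Iterates

theorem isCompact_setOf_infDist_le {T : Set F} (hT : IsCompact T) (hne : T.Nonempty) {ε : ℝ}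
    (hε : 0 ≤ ε) : IsCompact {w : F | infDist w T ≤ ε} := by
  refine hT.cthickening (r := ε) |>.of_isClosed_subset
    (isClosed_le (continuous_infDist_pt T) continuous_const) fun w hw => ?_
  rw [mem_cthickening_iff]
  exact (ENNReal.le_ofReal_iff_toReal_le (infEDist_ne_top hne) hε).2 hw

namespace Iterates

variable {S O : Set E} {g : F → EReal} {h : E → ℝ} {h' : E → E} {Lh : ℝ} {f : G → EReal}
  {A : E →L[ℝ] F} {K : E →L[ℝ] G} {γ ν β δ m : ℝ} {x u : ℕ → E} {y : ℕ → G} {z : ℕ → F}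
  {θ : ℕ → ℝ} (H : Iterates S O g h h' Lh f A K γ ν β δ m x u y z θ)

include H

theorem mem_of_tendsto {i : ℕ → ℕ} {xb : E} (hx : Tendsto (fun k => x (i k)) atTop (𝓝 xb)) :
    xb ∈ S :=
  H.isCompact.isClosed.mem_of_tendsto hx (Eventually.of_forall fun _ => H.x_mem _)

theorem z_mem_of_tendsto {i : ℕ → ℕ} {xb : E} {zb : F}
    (hx : Tendsto (fun k => x (i k)) atTop (𝓝 xb)) (hz : Tendsto (fun k => z (i k)) atTop (𝓝 zb)) :
    zb ∈ subdiff g (A xb - γ • zb) :=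
  mem_subdiff_of_tendsto H.g_proper.1 H.g_lsc H.g_proper.2 (fun k => H.z_mem (i k))
    (((A.continuous.tendsto xb).comp hx).sub (hz.const_smul γ)) hz

theorem y_mem_of_tendsto {i : ℕ → ℕ} {xb : E} {yb : G}
    (hx : Tendsto (fun k => x (i k)) atTop (𝓝 xb))
    (hy : Tendsto (fun k => y (i k + 1)) atTop (𝓝 yb)) : yb ∈ subdiff f (K xb) :=
  mem_subdiff_of_tendsto H.f_proper.1 H.f_lsc H.f_proper.2 (fun k => H.y_mem (i k))
    ((K.continuous.tendsto xb).comp hx) hy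

theorem psiR_eq_of_tendsto {i : ℕ → ℕ} (hi : Tendsto i atTop atTop) {xb ub : E} {zb : F} {l : ℝ}
    (hx : Tendsto (fun k => x (i k)) atTop (𝓝 xb)) (hz : Tendsto (fun k => z (i k)) atTop (𝓝 zb))
    (hu : Tendsto (fun k => u (i k)) atTop (𝓝 ub)) (hθ : Tendsto θ atTop (𝓝 l)) :
    psiR g h A δ γ xb zb ub = l * (f (K xb)).toReal := by
  have hxS := H.mem_of_tendsto hx
  have h1 : Tendsto (fun k => h (x (i k))) atTop (𝓝 (h xb)) :=
    (H.h_grad _ (H.subset hxS)).hasFDerivAt.continuousAt.tendsto.comp hx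
  have h2 : Tendsto (fun k => (conj g (z (i k))).toReal) atTop (𝓝 (conj g zb).toReal) :=
    (hasFDerivAt_conj H.g_proper H.g_convex H.g_lsc H.g_ess
      (H.z_mem_of_tendsto hx hz)).continuousAt.tendsto.comp hz
  have h3 : Tendsto (fun k => (f (K (x (i k)))).toReal) atTop (𝓝 (f (K xb)).toReal) :=
    (H.continuousOn_f xb hxS).tendsto.comp
      (tendsto_nhdsWithin_iff.2 ⟨hx, Eventually.of_forall fun _ => H.x_mem _⟩)
  have h4 : Tendsto (fun k => psiR g h A δ γ (x (i k)) (z (i k)) (u (i k))) atTop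
      (𝓝 (psiR g h A δ γ xb zb ub)) :=
    ((((hz.inner ((A.continuous.tendsto xb).comp hx)).add h1).add
      (((hx.sub hu).norm.pow 2).const_mul (δ / 2))).sub ((hz.norm.pow 2).const_mul (γ / 2))).sub h2
  have h5 := (hθ.comp hi).mul h3
  refine tendsto_nhds_unique h4 (h5.congr fun k => ?_)
  exact H.θ_mul (i k)

theorem tendsto_of_tendsto_succ {i : ℕ → ℕ} (hi : Tendsto i atTop atTop) {xb : E}
    (hx : Tendsto (fun k => x (i k + 1)) atTop (𝓝 xb)) :
    Tendsto (fun k => x (i k)) atTop (𝓝 xb) := by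
  have h1 : Tendsto (fun k => x (k + 1) - x k) atTop (𝓝 0) :=
    squeeze_zero_norm (norm_x_sub_le x u) H.tendsto_stepLen
  simpa using hx.sub (h1.comp hi)

theorem exists_linRatio_succ_add_le : ∃ c : ℝ, 0 < c ∧ ∀ k, linRatio g h f A K δ γ x u y z (k + 1)
    + c * stepLen x u (k + 1) ^ 2 ≤ linRatio g h f A K δ γ x u y z k :=
  let ⟨c, hc, h1⟩ := H.exists_linRatio_add_le
  ⟨c, hc, fun k => (h1 (k + 1)).trans (H.θ_succ_le_linRatio k)⟩

theorem summable_stepLen_of_KL_gamFn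
    (hKL : ∀ q, (limitingSubdiff (gamFn S g h f A K δ γ m) q).Nonempty →
      KLAt (gamFn S g h f A K δ γ m) q) : Summable (stepLen x u) := by
  obtain ⟨l, hl⟩ := H.exists_tendsto_θ
  obtain ⟨R, hR0, hR⟩ := H.exists_norm_le
  obtain ⟨C, hC, hsub⟩ := H.exists_frechetSubdiff_gamFn
  obtain ⟨c, hc, hdesc⟩ := H.exists_linRatio_succ_add_le
  refine summable_of_KL (Φ := gamFn S g h f A K δ γ m)
    (q := fun k => mkQuad (x (k + 1)) (y (k + 1)) (z (k + 1)) (u (k + 1)))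
    (Mb := l) hc hC (stepLen_nonneg x u) ?_
    (H.eventually_lt_linDen.mono fun k hk => H.gamFn_iterate hk) hsub
    (Eventually.of_forall hdesc) (H.tendsto_linRatio hl) H.tendsto_stepLen ?_ hKL
  · refine ⟨R + (R + (R + R)), fun k => (norm_mkQuad_le _ _ _ _).trans ?_⟩
    have h1 := hR (k + 1)
    linarith [(hR k).2.2.2]
  · intro ψ hψ p hp
    have hfst := (WithLp.fstL 2 ℝ E (WithLp 2 (G × WithLp 2 (F × E)))).continuous
    have hsnd := (WithLp.sndL 2 ℝ E (WithLp 2 (G × WithLp 2 (F × E)))).continuous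
    have hfst' := (WithLp.fstL 2 ℝ G (WithLp 2 (F × E))).continuous
    have hsnd' := (WithLp.sndL 2 ℝ G (WithLp 2 (F × E))).continuous
    have hx : Tendsto (fun k => x (ψ k + 1)) atTop (𝓝 p.fst) := (hfst.tendsto p).comp hp
    have hp₂ := (hsnd.tendsto p).comp hp
    have hy : Tendsto (fun k => y (ψ k + 1)) atTop (𝓝 p.snd.fst) :=
      (hfst'.tendsto p.snd).comp hp₂
    have hp₃ := (hsnd'.tendsto p.snd).comp hp₂
    have hz : Tendsto (fun k => z (ψ k + 1)) atTop (𝓝 p.snd.snd.fst) :=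
      ((WithLp.fstL 2 ℝ F E).continuous.tendsto p.snd.snd).comp hp₃
    have hu : Tendsto (fun k => u (ψ k + 1)) atTop (𝓝 p.snd.snd.snd) :=
      ((WithLp.sndL 2 ℝ F E).continuous.tendsto p.snd.snd).comp hp₃
    have hψ1 : Tendsto (fun k => ψ k + 1) atTop atTop :=
      (tendsto_add_atTop_nat 1).comp hψ.tendsto_atTop
    have hxS := H.mem_of_tendsto hx
    have hb := H.y_mem_of_tendsto (H.tendsto_of_tendsto_succ hψ.tendsto_atTop hx) hy
    have hm := H.le_f _ hxS
    have hm0 := H.m_pos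
    have h1 := H.psiR_eq_of_tendsto hψ1 hx hz hu hl
    have h2 := conj_eq_of_mem_subdiff H.f_proper.1 (H.f_eq hxS) hb
    have h3 : ⟪K p.fst, p.snd.fst⟫ - (⟪p.snd.fst, K p.fst⟫ - (f (K p.fst)).toReal)
        = (f (K p.fst)).toReal := by
      rw [real_inner_comm (K p.fst)]
      ring
    have h4 := gamFn_mkQuad S g h f A K δ γ m p.fst p.snd.snd.fst p.snd.snd.snd h2
      (by rw [h3]; linarith)
    rw [h3, psi_eq_psiR H.g_proper h A δ γ _ hxS (conj_ne_top_of_mem_subdiff H.g_proper.1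
      (H.z_mem_of_tendsto hx hz)), ← EReal.coe_div, h1,
      mul_div_cancel_right₀ _ (hm0.trans_le hm).ne'] at h4
    exact h4

theorem summable_stepLen_of_KL_piFn {O' : Set G} {f' : G → G} {Lf : ℝ} (hO' : IsOpen O')
    (hKO : K '' S ⊆ O') (hdom : ∀ w ∈ O', f w ≠ ⊤)
    (hgrad : ∀ w ∈ O', HasGradientAt (fun v => (f v).toReal) (f' w) w)
    (hlip : ∀ w ∈ O', ∀ v ∈ O', ‖f' w - f' v‖ ≤ Lf * ‖w - v‖)
    (hKL : ∀ q, (limitingSubdiff (piFn S g h f A K δ γ) q).Nonempty →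
      KLAt (piFn S g h f A K δ γ) q) : Summable (stepLen x u) := by
  obtain ⟨l, hl⟩ := H.exists_tendsto_θ
  obtain ⟨R, hR0, hR⟩ := H.exists_norm_le
  obtain ⟨C, hC, hsub⟩ := H.exists_frechetSubdiff_piFn hO' hKO hdom hgrad hlip
  obtain ⟨c, hc, hdesc⟩ := H.exists_linRatio_add_le
  have hpi : ∀ {a b c} {t : ℝ}, a ∈ S → conj g c ≠ ⊤ →
      psiR g h A δ γ a c b = t * (f (K a)).toReal →
      piFn S g h f A K δ γ (mkTrip a c b) = t := fun {a b c t} ha hc' ht => by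
    have h1 : piFn S g h f A K δ γ (mkTrip a c b) = psi S g h A δ γ a c b / f (K a) := rfl
    rw [h1, psi_eq_psiR H.g_proper h A δ γ b ha hc', H.f_eq ha, ← EReal.coe_div, ht,
      mul_div_cancel_right₀ _ (H.m_pos.trans_le (H.le_f _ ha)).ne']
  refine summable_of_KL (Φ := piFn S g h f A K δ γ)
    (q := fun k => mkTrip (x (k + 1)) (z (k + 1)) (u (k + 1))) (M := fun k => θ (k + 1))
    (Mb := l) hc hC (stepLen_nonneg x u) ?_
    (Eventually.of_forall fun k => hpi (H.x_mem _)
      (conj_ne_top_of_mem_subdiff H.g_proper.1 (H.z_mem _)) (H.θ_mul (k + 1)).symm)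
    (Eventually.of_forall hsub)
    (Eventually.of_forall fun k => (add_le_add (H.θ_succ_le_linRatio (k + 1)) le_rfl).trans
      (hdesc (k + 1))) ((tendsto_add_atTop_iff_nat 1).2 hl) H.tendsto_stepLen ?_ hKL
  · refine ⟨R + (R + R), fun k => (norm_mkTrip_le _ _ _).trans ?_⟩
    linarith [hR (k + 1)]
  · intro ψ hψ p hp
    have hx : Tendsto (fun k => x (ψ k + 1)) atTop (𝓝 p.fst) :=
      ((WithLp.fstL 2 ℝ E (WithLp 2 (F × E))).continuous.tendsto p).comp hp
    have hp₂ := ((WithLp.sndL 2 ℝ E (WithLp 2 (F × E))).continuous.tendsto p).comp hp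
    have hz : Tendsto (fun k => z (ψ k + 1)) atTop (𝓝 p.snd.fst) :=
      ((WithLp.fstL 2 ℝ F E).continuous.tendsto p.snd).comp hp₂
    have hu : Tendsto (fun k => u (ψ k + 1)) atTop (𝓝 p.snd.snd) :=
      ((WithLp.sndL 2 ℝ F E).continuous.tendsto p.snd).comp hp₂
    exact hpi (H.mem_of_tendsto hx) (conj_ne_top_of_mem_subdiff H.g_proper.1
      (H.z_mem_of_tendsto hx hz)) (H.psiR_eq_of_tendsto
        ((tendsto_add_atTop_nat 1).comp hψ.tendsto_atTop) hx hz hu hl)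

theorem summable_norm_sub_z (hs : Summable (stepLen x u)) :
    Summable fun k => ‖z k - z (k + 1)‖ := by
  refine .of_nonneg_of_le (fun k => norm_nonneg _) (fun k => ?_) (hs.mul_left (‖A‖ / γ))
  rw [norm_sub_rev]
  refine (H.norm_z_sub_le k).trans (mul_le_mul_of_nonneg_left (norm_x_sub_le x u k) ?_)
  exact div_nonneg (norm_nonneg _) H.γ_pos.le

theorem exists_isLiftedStat (hs : Summable (stepLen x u)) {ε κ : ℝ} (hε : 0 < ε) (hκ0 : 0 < κ)
    (hzb : ∀ k, ‖z (k + 1)‖ ≤ min (ε / γ) (Real.sqrt (2 * ε / γ)))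
    (hκ : ∀ a ∈ {w : F | infDist w (A '' S) ≤ ε}, ∀ b ∈ {w : F | infDist w (A '' S) ≤ ε},
      g a ≤ g b + ((κ * ‖a - b‖ : ℝ) : EReal)) :
    ∃ xb, Tendsto x atTop (𝓝 xb) ∧
      IsLiftedStat S g h h' f A K (2 * κ * ε) ((2 * κ + 1) * ε) xb := by
  have hγ := H.γ_pos
  obtain ⟨θb, hθ⟩ := H.exists_tendsto_θ
  obtain ⟨R, hR0, hR⟩ := H.exists_norm_le
  obtain ⟨xb, hx⟩ : ∃ xb, Tendsto x atTop (𝓝 xb) := by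
    refine cauchySeq_tendsto_of_complete (cauchySeq_of_summable_dist ?_)
    refine .of_nonneg_of_le (fun k => dist_nonneg) (fun k => ?_) hs
    rw [dist_comm, dist_eq_norm]
    exact norm_x_sub_le x u k
  obtain ⟨zb, hz⟩ : ∃ zb, Tendsto z atTop (𝓝 zb) := by
    refine cauchySeq_tendsto_of_complete (cauchySeq_of_summable_dist ?_)
    simpa only [dist_eq_norm] using H.summable_norm_sub_z hs
  have hx1 : Tendsto (fun k => x (k + 1)) atTop (𝓝 xb) := (tendsto_add_atTop_iff_nat 1).2 hx
  have hu : Tendsto u atTop (𝓝 xb) := by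
    have h1 : Tendsto (fun k => x (k + 1) - u (k + 1)) atTop (𝓝 0) :=
      squeeze_zero_norm H.norm_x_sub_u_succ_le (by simpa using H.tendsto_stepLen.const_mul β⁻¹)
    refine (tendsto_add_atTop_iff_nat 1).1 ?_
    simpa using hx1.sub h1
  obtain ⟨yb, -, φ, hφ, hy⟩ := tendsto_subseq_of_bounded (x := fun k => y (k + 1))
    (isBounded_closedBall (x := (0 : G)) (r := R)) fun k => by simpa using (hR k).2.2.2
  have hφ' := hφ.tendsto_atTop
  have hxS := H.mem_of_tendsto (i := id) hx
  have hzm := H.z_mem_of_tendsto (i := id) hx hz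
  have hΨ := H.psiR_eq_of_tendsto tendsto_id hx hz hu hθ
  have hzn : ‖zb‖ ≤ min (ε / γ) (Real.sqrt (2 * ε / γ)) :=
    le_of_tendsto ((tendsto_add_atTop_iff_nat 1).2 hz).norm (Eventually.of_forall hzb)
  have hγz : γ * ‖zb‖ ≤ ε := by
    rw [mul_comm, ← le_div_iff₀ hγ]
    exact hzn.trans (min_le_left _ _)
  have hγz2 : γ / 2 * ‖zb‖ ^ 2 ≤ ε := by
    have h1 : ‖zb‖ ^ 2 ≤ 2 * ε / γ := by
      rw [← Real.le_sqrt (norm_nonneg _) (by positivity)]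
      exact hzn.trans (min_le_right _ _)
    rw [le_div_iff₀ hγ] at h1
    linarith
  have hA : A xb ∈ A '' S := mem_image_of_mem _ hxS
  have hAK : A xb ∈ {w : F | infDist w (A '' S) ≤ ε} := by
    rw [mem_ofPred_eq, infDist_zero_of_mem hA]
    exact hε.le
  have hdist : ‖A xb - γ • zb - A xb‖ ≤ ε := by
    rw [sub_sub_cancel_left, norm_neg, norm_smul, Real.norm_of_nonneg hγ.le]
    exact hγz
  have hwK : A xb - γ • zb ∈ {w : F | infDist w (A '' S) ≤ ε} :=
    (infDist_le_dist_of_mem hA).trans (by rw [dist_eq_norm]; exact hdist)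
  obtain ⟨r, hr⟩ := exists_real_of_ne_top H.g_proper.1 hzm.1
  obtain ⟨s, hs⟩ : ∃ s : ℝ, g (A xb) = s := by
    refine exists_real_of_ne_top H.g_proper.1 fun h1 => ?_
    have h2 := hκ _ hAK _ hwK
    rw [h1, hr, ← EReal.coe_add] at h2
    exact EReal.coe_ne_top _ (top_le_iff.1 h2)
  have hκε : κ * ‖A xb - γ • zb - A xb‖ ≤ κ * ε := mul_le_mul_of_nonneg_left hdist hκ0.le
  have hsr : s ≤ r + κ * ε := by
    have h2 := hκ _ hAK _ hwK
    rw [hs, hr, ← EReal.coe_add, EReal.coe_le_coe_iff, norm_sub_rev] at h2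
    linarith
  have hrs : r ≤ s + κ * ε := by
    have h2 := hκ _ hwK _ hAK
    rw [hs, hr, ← EReal.coe_add, EReal.coe_le_coe_iff] at h2
    linarith
  have hpos : 0 ≤ κ * ε := by positivity
  refine ⟨xb, hx, psiR g h A δ γ xb zb xb, ?_, zb, ⟨by rw [hs]; exact EReal.coe_ne_top _,
    fun w => ?_⟩, -(ContinuousLinearMap.adjoint A zb - θb • ContinuousLinearMap.adjoint K yb
      + h' xb), ?_, yb, H.y_mem_of_tendsto (hx.comp hφ') hy, ?_⟩
  · have h1 : psiR g h A δ γ xb zb xb = r + γ / 2 * ‖zb‖ ^ 2 + h xb := by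
      rw [psiR, conj_eq_of_mem_subdiff H.g_proper.1 hr hzm, EReal.toReal_coe, inner_sub_right,
        real_inner_smul_right, real_inner_self_eq_norm_sq, sub_self, norm_zero]
      ring
    have h2 : 0 ≤ γ / 2 * ‖zb‖ ^ 2 := by positivity
    rw [h1, hs, EReal.toReal_coe]
    exact abs_le.2 ⟨by linarith, by linarith⟩
  · rw [hs, ← EReal.coe_add]
    refine coe_le_of_forall_real fun t ht => ?_
    have h1 := (mem_subdiff_iff hr).1 hzm w t ht
    rw [sub_sub_eq_add_sub, add_sub_right_comm, inner_add_right, real_inner_smul_right,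
      real_inner_self_eq_norm_sq] at h1
    have h2 : 0 ≤ γ * ‖zb‖ ^ 2 := by positivity
    linarith
  · have hi : indicatorFn S xb = ((0 : ℝ) : EReal) := if_pos hxS
    refine (mem_subdiff_iff hi).2 fun w t ht => ?_
    by_cases hw : w ∈ S
    · have ht0 : (0 : ℝ) ≤ t := by
        rw [indicatorFn, if_pos hw] at ht
        exact_mod_cast ht
      have hh : Tendsto (fun k => h' (x k)) atTop (𝓝 (h' xb)) := by
        rw [tendsto_iff_norm_sub_tendsto_zero]
        refine squeeze_zero (fun k => norm_nonneg _)
          (fun k => H.h_lip _ (H.subset (H.x_mem k)) _ (H.subset hxS)) ?_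
        simpa using (tendsto_iff_norm_sub_tendsto_zero.1 hx).const_mul Lh
      have h1 : Tendsto (fun k => ⟪ContinuousLinearMap.adjoint A (z (φ k))
          - θ (φ k) • ContinuousLinearMap.adjoint K (y (φ k + 1)) + h' (x (φ k))
          + δ • (x (φ k + 1) - u (φ k)), w - x (φ k + 1)⟫) atTop
          (𝓝 ⟪ContinuousLinearMap.adjoint A zb - θb • ContinuousLinearMap.adjoint K yb + h' xb
            + δ • (xb - xb), w - xb⟫) :=
        (((((((ContinuousLinearMap.adjoint A).continuous.tendsto zb).comp (hz.comp hφ')).sub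
          ((hθ.comp hφ').smul (((ContinuousLinearMap.adjoint K).continuous.tendsto yb).comp
            hy))).add (hh.comp hφ')).add (((hx1.comp hφ').sub (hu.comp hφ')).const_smul δ))).inner
          (tendsto_const_nhds.sub (hx1.comp hφ'))
      have h2 := ge_of_tendsto' h1 fun k => H.inner_nonneg (φ k) w hw
      rw [sub_self, smul_zero, add_zero] at h2
      rw [inner_neg_left]
      linarith
    · rw [indicatorFn, if_neg hw] at ht
      exact absurd (top_le_iff.1 ht) (EReal.coe_ne_top _)
  · rw [hΨ]
    module

end Iterates

theorem IsAlgoSeq.summable_and_exists_isLiftedStat {S : Set E} {g : F → EReal} {h : E → ℝ}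
    {h' : E → E} {Lh : ℝ} {f : G → EReal} {A : E →L[ℝ] F} {K : E →L[ℝ] G}
    (hA1 : Assumption1 S g h h' Lh f A K) (hA2 : Assumption2 S g A) (hLh : 0 ≤ Lh)
    {γ ν β δ : ℝ} (hγ : 0 < γ) (hν : 0 < ν) (hβ : β ∈ Ioo (0 : ℝ) 2)
    (hδ : δ = 2 * ν + Lh + 2 * ‖A‖ ^ 2 / γ)
    {x u : ℕ → E} {y : ℕ → G} {z : ℕ → F} {θ : ℕ → ℝ}
    (halg : IsAlgoSeq S g h h' f A K γ δ β x u y z θ) {ε : ℝ} (hε : 0 < ε)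
    (hzb : ∀ k, ‖z (k + 1)‖ ≤ min (ε / γ) (Real.sqrt (2 * ε / γ)))
    (hKε : {w : F | infDist w (A '' S) ≤ ε} ⊆ interior (edom g))
    (hess : EssStrictConvexFn g) {m : ℝ} (hm : 0 < m) (hmb : ∀ x' ∈ S, (m : EReal) ≤ f (K x'))
    (hcase : (∀ q, (limitingSubdiff (gamFn S g h f A K δ γ m) q).Nonempty →
          KLAt (gamFn S g h f A K δ γ m) q) ∨
      ((∃ O' : Set G, IsOpen O' ∧ K '' S ⊆ O' ∧ ∃ f' : G → G, ∃ Lf : ℝ,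
          (∀ w ∈ O', f w ≠ ⊤) ∧
          (∀ w ∈ O', HasGradientAt (fun v => (f v).toReal) (f' w) w) ∧
          ∀ w ∈ O', ∀ v ∈ O', ‖f' w - f' v‖ ≤ Lf * ‖w - v‖) ∧
        ∀ q, (limitingSubdiff (piFn S g h f A K δ γ) q).Nonempty →
          KLAt (piFn S g h f A K δ γ) q)) :
    Summable (fun k => ‖x k - x (k + 1)‖ + ‖u k - u (k + 1)‖ + ‖z k - z (k + 1)‖) ∧
    ∃ κ : ℝ, 0 < κ ∧
      (∀ a ∈ {w : F | infDist w (A '' S) ≤ ε}, ∀ b ∈ {w : F | infDist w (A '' S) ≤ ε},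
        g a ≤ g b + ((κ * ‖a - b‖ : ℝ) : EReal)) ∧
      ∃ xb : E, Tendsto x atTop (nhds xb) ∧
        IsLiftedStat S g h h' f A K (2 * κ * ε) ((2 * κ + 1) * ε) xb := by
  obtain ⟨O, H⟩ := halg.iterates hA1 hA2 hLh hγ hν hβ hδ hess hm hmb
  have hs : Summable (stepLen x u) := by
    rcases hcase with hKL | ⟨⟨O', hO', hKO, f', Lf, hdom, hgrad, hlip⟩, hKL⟩
    · exact H.summable_stepLen_of_KL_gamFn hKL
    · exact H.summable_stepLen_of_KL_piFn hO' hKO hdom hgrad hlip hKL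
  obtain ⟨κ, hκ0, hκ⟩ := exists_lipschitz_of_isCompact H.g_proper.1 H.g_convex
    (isCompact_setOf_infDist_le (H.isCompact.image A.continuous) (hA1.1.image A) hε.le) hKε
  exact ⟨hs.add (H.summable_norm_sub_z hs), κ, hκ0, hκ, H.exists_isLiftedStat hs hε hκ0 hzb hκ⟩

theorem Assumption1.nonneg_of_nontrivial [Nontrivial E] {S : Set E} {g : F → EReal} {h : E → ℝ}
    {h' : E → E} {Lh : ℝ} {f : G → EReal} {A : E →L[ℝ] F} {K : E →L[ℝ] G}
    (hA1 : Assumption1 S g h h' Lh f A K) : 0 ≤ Lh := by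
  obtain ⟨⟨a, ha⟩, -, -, -, -, -, ⟨O, hO, hSO, -, hlip⟩, -⟩ := hA1
  obtain ⟨b, hb, hba⟩ := mem_closure_iff_nhds.1 (dense_compl_singleton a a) O
    (hO.mem_nhds (hSO ha))
  exact nonneg_of_mul_nonneg_left ((norm_nonneg _).trans (hlip a (hSO ha) b hb))
    (norm_pos_iff.2 (sub_ne_zero.2 (Ne.symm hba)))

theorem Assumption1.zero_of_subsingleton [Subsingleton E] {S : Set E} {g : F → EReal} {h : E → ℝ}
    {h' : E → E} {Lh : ℝ} {f : G → EReal} {A : E →L[ℝ] F} {K : E →L[ℝ] G}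
    (hA1 : Assumption1 S g h h' Lh f A K) : Assumption1 S g h h' 0 f A K := by
  obtain ⟨h1, h2, h3, h4, h5, h6, ⟨O, hO, hSO, hgr, -⟩, h7⟩ := hA1
  refine ⟨h1, h2, h3, h4, h5, h6, ⟨O, hO, hSO, hgr, fun a _ b _ => ?_⟩, h7⟩
  simp [Subsingleton.elim a b]

theorem psi_congr_of_subsingleton [Subsingleton E] (S : Set E) (g : F → EReal) (h : E → ℝ)
    (A : E →L[ℝ] F) (δ δ' γ : ℝ) : psi S g h A δ γ = psi S g h A δ' γ := by
  funext x z u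
  simp [psi, Subsingleton.elim x u]

theorem IsAlgoSeq.congr_of_subsingleton [Subsingleton E] {S : Set E} {g : F → EReal} {h : E → ℝ}
    {h' : E → E} {f : G → EReal} {A : E →L[ℝ] F} {K : E →L[ℝ] G} {γ δ β : ℝ} {x u : ℕ → E}
    {y : ℕ → G} {z : ℕ → F} {θ : ℕ → ℝ} (halg : IsAlgoSeq S g h h' f A K γ δ β x u y z θ) (δ' : ℝ) :
    IsAlgoSeq S g h h' f A K γ δ' β x u y z θ := by
  obtain ⟨h1, h2, h3, h4, h5, h6⟩ := halg
  refine ⟨h1, h2, ?_, h4, fun k => ⟨(h5 k).1, fun w _ => ?_⟩, h6⟩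
  · rwa [psi_congr_of_subsingleton S g h A δ' δ γ]
  · rw [Subsingleton.elim w (x (k + 1))]

/-- global convergence of the algorithm under the KL property. -/
theorem global_convergence
    (S : Set E) (g : F → EReal) (h : E → ℝ) (h' : E → E) (Lh : ℝ)
    (f : G → EReal) (A : E →L[ℝ] F) (K : E →L[ℝ] G)
    (hA1 : Assumption1 S g h h' Lh f A K) (hA2 : Assumption2 S g A)
    (γ ν β δ : ℝ) (hγ : 0 < γ) (hν : 0 < ν) (hβ : β ∈ Ioo (0 : ℝ) 2)
    (hδ : δ = 2 * ν + Lh + 2 * ‖A‖ ^ 2 / γ)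
    (x u : ℕ → E) (y : ℕ → G) (z : ℕ → F) (θ : ℕ → ℝ)
    (halg : IsAlgoSeq S g h h' f A K γ δ β x u y z θ)
    (ε : ℝ) (hε : 0 < ε)
    (hzb : ∀ k, ‖z (k + 1)‖ ≤ min (ε / γ) (Real.sqrt (2 * ε / γ)))
    (hKε : {w : F | infDist w (A '' S) ≤ ε} ⊆ interior (edom g))
    (hess : EssStrictConvexFn g)
    (m : ℝ) (hm : 0 < m) (hmb : ∀ x' ∈ S, (m : EReal) ≤ f (K x'))
    (hcase :
      ((∀ yy ∈ edom (conj f), CalmAt (conj f) yy) ∧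
        ∀ q, (limitingSubdiff (gamFn S g h f A K δ γ m) q).Nonempty →
          KLAt (gamFn S g h f A K δ γ m) q) ∨
      ((∃ O' : Set G, IsOpen O' ∧ K '' S ⊆ O' ∧ ∃ f' : G → G, ∃ Lf : ℝ,
          (∀ w ∈ O', f w ≠ ⊤) ∧
          (∀ w ∈ O', HasGradientAt (fun v => (f v).toReal) (f' w) w) ∧
          ∀ w ∈ O', ∀ v ∈ O', ‖f' w - f' v‖ ≤ Lf * ‖w - v‖) ∧
        ∀ q, (limitingSubdiff (piFn S g h f A K δ γ) q).Nonempty →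
          KLAt (piFn S g h f A K δ γ) q)) :
    Summable (fun k => ‖x k - x (k + 1)‖ + ‖u k - u (k + 1)‖ + ‖z k - z (k + 1)‖) ∧
    ∃ κ : ℝ, 0 < κ ∧
      (∀ a ∈ {w : F | infDist w (A '' S) ≤ ε}, ∀ b ∈ {w : F | infDist w (A '' S) ≤ ε},
        g a ≤ g b + ((κ * ‖a - b‖ : ℝ) : EReal)) ∧
      ∃ xb : E, Tendsto x atTop (nhds xb) ∧
        IsLiftedStat S g h h' f A K (2 * κ * ε) ((2 * κ + 1) * ε) xb := by
  rcases subsingleton_or_nontrivial E with hE | hE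
  · have hψ := psi_congr_of_subsingleton S g h A δ (2 * ν + 0 + 2 * ‖A‖ ^ 2 / γ) γ
    have hgam : gamFn S g h f A K δ γ m = gamFn S g h f A K (2 * ν + 0 + 2 * ‖A‖ ^ 2 / γ) γ m := by
      unfold gamFn
      rw [hψ]
    have hpi : piFn S g h f A K δ γ = piFn S g h f A K (2 * ν + 0 + 2 * ‖A‖ ^ 2 / γ) γ := by
      unfold piFn
      rw [hψ]
    rw [hgam, hpi] at hcase
    exact (halg.congr_of_subsingleton _).summable_and_exists_isLiftedStat hA1.zero_of_subsingleton
      hA2 le_rfl hγ hν hβ rfl hε hzb hKε hess hm hmb (hcase.imp_left And.right)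
  · exact halg.summable_and_exists_isLiftedStat hA1 hA2 hA1.nonneg_of_nontrivial hγ hν hβ hδ hε hzb
      hKε hess hm hmb (hcase.imp_left And.right)

end FracPaper
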